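/- arXiv:2510.09562 — 2 statements merged into one kernel-verified Lean document; each statement's English description precedes it below -/
import Mathlib

section
/- On a probability space, let X₁, X₂, … be nonnegative random variables with common survival function P(Xᵢ > x) = x^{-α} l(x) for all x > 0, where α > 0 and l is slowly varying at infinity. Let h₁, h₂ > α, and suppose that for every positive sequence (c_n) with c_n → ∞, (n·c_n) nondecreasing and tending to ∞, and log c_n = o(log n), and every positive sequence (v_n) with n·l(v_n)/(v_n^α·c_n) → 1, Condition A(h₁) and Condition A(h₂) hold. Let R_n := log M_{n,h₁}/log M_{n,h₂} − (h₁−α)/(h₂−α). (i) If l(x) → ∞ as x → ∞, then R_n = O_p(s_{1n,l}) and R_n^{-1} = O_p(s_{2n,l}^{-1}). (ii) If l(x) → 0 as x → ∞, then R_n = O_p(s_{2n,l}) and R_n^{-1} = O_p(s_{1n,l}^{-1}). -/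
open MeasureTheory Filter

noncomputable section

/-- `l` is slowly varying at infinity: for every `lam > 0`, `l(lam*x)/l(x) → 1` as `x → ∞`. -/
def SlowlyVarying (l : ℝ → ℝ) : Prop :=
  ∀ lam : ℝ, 0 < lam → Tendsto (fun x => l (lam * x) / l x) atTop (nhds 1)

/-- Covariance `Cov(U,V) = E[UV] - E[U]E[V]`. -/
def cov {Ω : Type*} [MeasurableSpace Ω] (μ : Measure Ω) (U V : Ω → ℝ) : ℝ :=
  (∫ ω, U ω * V ω ∂μ) - (∫ ω, U ω ∂μ) * (∫ ω, V ω ∂μ)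

/-- Truncation `X·1(X < t)`. -/
def trunc {Ω : Type*} (X : Ω → ℝ) (t : ℝ) : Ω → ℝ :=
  fun ω => if X ω < t then X ω else 0

/-- Sum of covariances of `p`-th powers of the variables truncated at `v n`,
over distinct pairs of indices among the first `n`. -/
def covSum {Ω : Type*} [MeasurableSpace Ω] (μ : Measure Ω) (X : ℕ → Ω → ℝ)
    (v : ℕ → ℝ) (p : ℝ) (n : ℕ) : ℝ :=
  ∑ i ∈ Finset.range n, ∑ j ∈ Finset.range n,
    if i = j then 0
    else cov μ (fun ω => trunc (X i) (v n) ω ^ p) (fun ω => trunc (X j) (v n) ω ^ p)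

/-- Condition A(p). -/
def ConditionA {Ω : Type*} [MeasurableSpace Ω] (μ : Measure Ω) (X : ℕ → Ω → ℝ)
    (v c : ℕ → ℝ) (p : ℝ) : Prop :=
  Tendsto (fun n => covSum μ X v p n / (v n ^ (2 * p) * c n ^ 2)) atTop (nhds 0)

/-- `p`-th sample moment `M_{n,p}`. -/
def sampleMoment {Ω : Type*} (X : ℕ → Ω → ℝ) (p : ℝ) (n : ℕ) (ω : Ω) : ℝ :=
  (n : ℝ)⁻¹ * ∑ i ∈ Finset.range n, X i ω ^ p

/-- `Y_n = O_p(r_n)`. -/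
def IsOp {Ω : Type*} [MeasurableSpace Ω] (μ : Measure Ω) (Y : ℕ → Ω → ℝ) (r : ℕ → ℝ) : Prop :=
  ∀ ε : ℝ, 0 < ε → ∃ C : ℝ, 0 < C ∧
    ∀ᶠ n in atTop, (μ {ω | C * r n < |Y n ω|}).toReal < ε

/-- Convergence in probability to a constant. -/
def TendstoInProbability {Ω : Type*} [MeasurableSpace Ω] (μ : Measure Ω)
    (Y : ℕ → Ω → ℝ) (a : ℝ) : Prop :=
  ∀ ε : ℝ, 0 < ε → Tendsto (fun n => (μ {ω | ε < |Y n ω - a|}).toReal) atTop (nhds 0)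

/-- The window `J_n = [n^{1/(α+δ)}, n^{(1+δ)/(α−δ)}]`. -/
def Jset (α δ : ℝ) (n : ℕ) : Set ℝ :=
  Set.Icc ((n : ℝ) ^ (1 / (α + δ))) ((n : ℝ) ^ ((1 + δ) / (α - δ)))

/-- `l_{1n} = (2 max{l(n), l(n)⁻¹, 1} · sup_{x ∈ J_n} l(x))^{1/α}`. -/
def lOne (l : ℝ → ℝ) (α δ : ℝ) (n : ℕ) : ℝ :=
  (2 * max (max (l n) (l n)⁻¹) 1 * sSup (l '' Jset α δ n)) ^ (1 / α)

/-- `l_{2n} = ((1/2) · inf_{x ∈ J_n} l(x))^{1/α}`. -/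
def lTwo (l : ℝ → ℝ) (α δ : ℝ) (n : ℕ) : ℝ :=
  ((1 / 2) * sInf (l '' Jset α δ n)) ^ (1 / α)

/-- The interval `I_{n,l} = [n^{1/α} l_{2n}, n^{1/α} l_{1n}]`. -/
def Iset (l : ℝ → ℝ) (α δ : ℝ) (n : ℕ) : Set ℝ :=
  Set.Icc ((n : ℝ) ^ (1 / α) * lTwo l α δ n) ((n : ℝ) ^ (1 / α) * lOne l α δ n)

/-- `s_{1n,l} = |log (sup_{x ∈ I_{n,l}} l(x))| / log n`. -/
def sOne (l : ℝ → ℝ) (α δ : ℝ) (n : ℕ) : ℝ :=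
  |Real.log (sSup (l '' Iset l α δ n))| / Real.log n

/-- `s_{2n,l} = |log (inf_{x ∈ I_{n,l}} l(x))| / log n`. -/
def sTwo (l : ℝ → ℝ) (α δ : ℝ) (n : ℕ) : ℝ :=
  |Real.log (sInf (l '' Iset l α δ n))| / Real.log n

open Topology

/-- Regularly varying survival function. -/
structure RV (F : ℝ → ℝ) (α : ℝ) : Prop where
  pos : ∀ x, 0 < x → 0 < F x
  anti : ∀ x y, 0 < x → x ≤ y → F y ≤ F x
  rv : ∀ lam, 0 < lam → Tendsto (fun x => F (lam * x) / F x) atTop (𝓝 (lam ^ (-α)))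

lemma dyadic_ind (P : ℝ → Prop) (x0 : ℝ) (hx0 : 0 < x0)
    (hb : ∀ u, x0 ≤ u → u ≤ 2 * x0 → P u) (hs : ∀ u, x0 ≤ u → P u → P (2 * u)) :
    ∀ u, x0 ≤ u → P u := by
  have key : ∀ n : ℕ, ∀ u, x0 ≤ u → u ≤ 2 ^ n * x0 → P u := by
    intro n
    induction n with
    | zero =>
      intro u h1 h2
      exact hb u h1 (by simp at h2; linarith)
    | succ k ih =>
      intro u h1 h2
      by_cases h : u ≤ 2 * x0
      · exact hb u h1 h
      · push Not at h
        have := hs (u / 2) (by linarith) (ih (u / 2) (by linarith) (by rw [pow_succ] at h2; linarith))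
        rwa [mul_div_cancel₀ _ (two_ne_zero)] at this
  intro u hu
  obtain ⟨n, hn⟩ := pow_unbounded_of_one_lt (u / x0) (one_lt_two)
  exact key n u hu (by rw [div_lt_iff₀ hx0] at hn; exact hn.le)

lemma potter_upper {F : ℝ → ℝ} {α : ℝ} (h : RV F α) {β : ℝ} (hβ : 0 < β) (hβα : β < α) :
    ∃ x0 > 0, ∃ A > 0, ∀ x, x0 ≤ x → ∀ r, 1 ≤ r → F (r * x) ≤ A * r ^ (-β) * F x := by
  have h1 : (2:ℝ) ^ (-α) < 2 ^ (-β) := Real.rpow_lt_rpow_of_exponent_lt one_lt_two (by linarith)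
  have h2 := ((h.rv 2 two_pos).eventually (gt_mem_nhds h1)).and (eventually_gt_atTop 0)
  obtain ⟨x0, hx0⟩ := eventually_atTop.1 h2
  refine ⟨max x0 1, by positivity, 2 ^ β, by positivity, ?_⟩
  intro x hx r hr
  have hxp : 0 < x := lt_of_lt_of_le one_pos ((le_max_right _ _).trans hx)
  refine dyadic_ind (fun r => F (r * x) ≤ 2 ^ β * r ^ (-β) * F x) 1 one_pos ?_ ?_ r hr
  · intro u hu1 hu2
    have h3 : F (u * x) ≤ F x := h.anti _ _ hxp (by nlinarith)
    have h4 : (2:ℝ) ^ (-β) ≤ u ^ (-β) :=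
      Real.rpow_le_rpow_of_nonpos (by linarith) (by linarith) (by linarith)
    have h5 : (1:ℝ) ≤ 2 ^ β * u ^ (-β) := by
      calc (1:ℝ) = 2 ^ β * 2 ^ (-β) := by rw [← Real.rpow_add two_pos]; simp
        _ ≤ _ := by gcongr
    have := h.pos x hxp
    nlinarith
  · intro u hu ih
    have hux : x0 ≤ u * x := by
      have := (le_max_left x0 1).trans hx
      nlinarith
    have hup : 0 < u * x := by positivity
    have h3 := (hx0 (u * x) hux).1
    rw [div_lt_iff₀ (h.pos _ hup)] at h3
    have h4 : (2 * u) ^ (-β) = 2 ^ (-β) * u ^ (-β) := Real.mul_rpow (by norm_num) (by linarith)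
    show F (2 * u * x) ≤ _
    rw [mul_assoc, h4]
    have h6 : (0:ℝ) < 2 ^ (-β) := by positivity
    calc F (2 * (u * x)) ≤ 2 ^ (-β) * F (u * x) := h3.le
      _ ≤ 2 ^ (-β) * (2 ^ β * u ^ (-β) * F x) := by gcongr
      _ = _ := by ring

lemma potter_lower {F : ℝ → ℝ} {α : ℝ} (h : RV F α) {β : ℝ} (hβ : 0 < β) (hβα : α < β) :
    ∃ x0 > 0, ∃ A > 0, ∀ x, x0 ≤ x → ∀ r, 1 ≤ r → A * r ^ (-β) * F x ≤ F (r * x) := by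
  have h1 : (2:ℝ) ^ (-β) < 2 ^ (-α) := Real.rpow_lt_rpow_of_exponent_lt one_lt_two (by linarith)
  have h2 := ((h.rv 2 two_pos).eventually (lt_mem_nhds h1)).and (eventually_gt_atTop 0)
  obtain ⟨x0, hx0⟩ := eventually_atTop.1 h2
  refine ⟨max x0 1, by positivity, 2 ^ (-β), by positivity, ?_⟩
  intro x hx r hr
  have hxp : 0 < x := lt_of_lt_of_le one_pos ((le_max_right _ _).trans hx)
  have hFx := h.pos x hxp
  refine dyadic_ind (fun r => 2 ^ (-β) * r ^ (-β) * F x ≤ F (r * x)) 1 one_pos ?_ ?_ r hr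
  · intro u hu1 hu2
    have h3 : F (2 * x) ≤ F (u * x) := h.anti _ _ (by positivity) (by nlinarith)
    have h4 : u ^ (-β) ≤ 1 := Real.rpow_le_one_of_one_le_of_nonpos hu1 (by linarith)
    have h5 := (hx0 x ((le_max_left _ _).trans hx)).1
    rw [lt_div_iff₀ hFx] at h5
    calc 2 ^ (-β) * u ^ (-β) * F x ≤ 2 ^ (-β) * 1 * F x := by gcongr
      _ ≤ _ := by linarith
  · intro u hu ih
    have hux : x0 ≤ u * x := by
      have := (le_max_left x0 1).trans hx
      nlinarith
    have hup : 0 < u * x := by positivity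
    have h3 := (hx0 (u * x) hux).1
    rw [lt_div_iff₀ (h.pos _ hup)] at h3
    have h4 : (2 * u) ^ (-β) = 2 ^ (-β) * u ^ (-β) := Real.mul_rpow (by norm_num) (by linarith)
    show _ ≤ F (2 * u * x)
    rw [mul_assoc 2 u x, h4]
    have h6 : (0:ℝ) < 2 ^ (-β) := by positivity
    calc _ = 2 ^ (-β) * (2 ^ (-β) * u ^ (-β) * F x) := by ring
      _ ≤ 2 ^ (-β) * F (u * x) := by gcongr
      _ ≤ _ := h3.le

lemma log_rv {F : ℝ → ℝ} {α : ℝ} (hα : 0 < α) (h : RV F α) (η : ℝ) (hη : 0 < η) :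
    ∀ᶠ x in atTop, |Real.log (x ^ α * F x)| ≤ η * Real.log x := by
  set e := min η α / 2 with he
  have he0 : 0 < e := by positivity
  have he1 : e < α := by have := min_le_right η α; rw [he]; linarith [lt_min hη hα]
  have he2 : 2 * e ≤ η := by have := min_le_left η α; rw [he]; linarith
  obtain ⟨x0, hx0, A, hA, HA⟩ := potter_upper h (β := α - e) (by linarith) (by linarith)
  obtain ⟨y0, hy0, B, hB, HB⟩ := potter_lower h (β := α + e) (by linarith) (by linarith)
  have hlog := Real.tendsto_log_atTop
  have hF0 := h.pos x0 hx0
  have hG0 := h.pos y0 hy0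
  filter_upwards [eventually_ge_atTop x0, eventually_ge_atTop y0, eventually_gt_atTop 1,
    hlog.eventually_ge_atTop ((Real.log A + (α - e) * Real.log x0 + Real.log (F x0)) / e),
    hlog.eventually_ge_atTop (-(Real.log B + (α + e) * Real.log y0 + Real.log (F y0)) / e)]
    with x hxx hxy hx1 hl1 hl2
  have hxp : 0 < x := by linarith
  have hFx := h.pos x hxp
  have hlx : 0 < Real.log x := Real.log_pos hx1
  rw [Real.log_mul (by positivity) hFx.ne', Real.log_rpow hxp]
  have k1 := HA x0 le_rfl (x / x0) (by rw [le_div_iff₀ hx0]; linarith)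
  have k2 := HB y0 le_rfl (x / y0) (by rw [le_div_iff₀ hy0]; linarith)
  rw [div_mul_cancel₀ _ hx0.ne'] at k1
  rw [div_mul_cancel₀ _ hy0.ne'] at k2
  have k1' := Real.log_le_log hFx k1
  have k2' := Real.log_le_log (by positivity) k2
  rw [Real.log_mul (by positivity) hF0.ne', Real.log_mul hA.ne' (by positivity),
    Real.log_rpow (by positivity), Real.log_div hxp.ne' hx0.ne'] at k1'
  rw [Real.log_mul (by positivity) hG0.ne', Real.log_mul hB.ne' (by positivity),
    Real.log_rpow (by positivity), Real.log_div hxp.ne' hy0.ne'] at k2'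
  rw [div_le_iff₀ he0] at hl1 hl2
  have : 2 * e * Real.log x ≤ η * Real.log x := by gcongr
  rw [abs_le]
  constructor <;> nlinarith

lemma rv_tendsto_zero {F : ℝ → ℝ} {α : ℝ} (hα : 0 < α) (h : RV F α) :
    Tendsto F atTop (𝓝 0) := by
  obtain ⟨x0, hx0, A, hA, HA⟩ := potter_upper h (β := α / 2) (by linarith) (by linarith)
  have h1 : Tendsto (fun x : ℝ => A * (x / x0) ^ (-(α/2)) * F x0) atTop (𝓝 0) := by
    have := (tendsto_rpow_neg_atTop (y := α / 2) (by linarith)).comp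
      (tendsto_id.atTop_div_const hx0)
    simpa using (this.const_mul A).mul_const (F x0)
  refine tendsto_of_tendsto_of_tendsto_of_le_of_le' tendsto_const_nhds h1 ?_ ?_
  · filter_upwards [eventually_gt_atTop 0] with x hx using (h.pos x hx).le
  · filter_upwards [eventually_ge_atTop x0] with x hx
    have := HA x0 le_rfl (x / x0) (by rw [le_div_iff₀ hx0]; linarith)
    rwa [div_mul_cancel₀ _ hx0.ne'] at this

lemma quantile {F : ℝ → ℝ} {α : ℝ} (hα : 0 < α) (h : RV F α) :
    ∃ Q : ℝ → ℝ, (∀ t, 0 < Q t) ∧ Tendsto Q (𝓝[>] 0) atTop ∧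
      Tendsto (fun t => F (Q t) / t) (𝓝[>] 0) (𝓝 1) := by
  classical
  let S : ℝ → Set ℝ := fun t => {x | 0 < x ∧ F x ≤ t}
  let Q : ℝ → ℝ := fun t => if 0 < sInf (S t) then sInf (S t) else 1
  have hF0 := rv_tendsto_zero hα h
  have hne : ∀ t, 0 < t → (S t).Nonempty := by
    intro t ht
    obtain ⟨x, hx1, hx2⟩ := ((hF0.eventually (gt_mem_nhds ht)).and (eventually_gt_atTop 0)).exists
    exact ⟨x, hx2, hx1.le⟩
  have hbdd : ∀ t, BddBelow (S t) := fun t => ⟨0, fun x hx => hx.1.le⟩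
  have hge : ∀ t, 0 < t → ∀ x, 0 < x → t < F x → x ≤ sInf (S t) := by
    intro t ht x hx hxt
    refine le_csInf (hne t ht) ?_
    intro y hy
    by_contra hlt
    push Not at hlt
    have := h.anti y x hy.1 hlt.le
    linarith [hy.2]
  have hQpos : ∀ t, 0 < Q t := by
    intro t
    simp only [Q]
    split_ifs with h0
    · exact h0
    · exact one_pos
  have hpos : ∀ᶠ t in 𝓝[>] (0:ℝ), 0 < t := eventually_mem_nhdsWithin
  have hbig : ∀ x, 0 < x → ∀ᶠ t in 𝓝[>] (0:ℝ), x ≤ sInf (S t) := by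
    intro x hx
    have : ∀ᶠ t in 𝓝[>] (0:ℝ), t < F x :=
      (gt_mem_nhds (h.pos x hx)).filter_mono nhdsWithin_le_nhds
    filter_upwards [this, hpos] with t h1 h2 using hge t h2 x hx h1
  have hQeq : ∀ᶠ t in 𝓝[>] (0:ℝ), Q t = sInf (S t) := by
    filter_upwards [hbig 1 one_pos] with t ht
    simp only [Q]
    rw [if_pos (by linarith)]
  have hQt : Tendsto Q (𝓝[>] 0) atTop := by
    rw [tendsto_atTop]
    intro b
    filter_upwards [hbig (max b 1) (by positivity), hQeq] with t h1 h2
    rw [h2]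
    exact (le_max_left _ _).trans h1
  have hup : ∀ᶠ t in 𝓝[>] (0:ℝ), ∀ r, 1 < r → F (r * Q t) ≤ t := by
    filter_upwards [hQeq, hpos] with t h1 h2 r hr
    have hq := hQpos t
    have : sInf (S t) < r * Q t := by rw [← h1]; nlinarith
    obtain ⟨y, hy, hy2⟩ := exists_lt_of_csInf_lt (hne t h2) this
    exact (h.anti _ _ hy.1 hy2.le).trans hy.2
  have hdn : ∀ᶠ t in 𝓝[>] (0:ℝ), ∀ r, 0 < r → r < 1 → t ≤ F (r * Q t) := by
    filter_upwards [hQeq, hpos] with t h1 h2 r hr0 hr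
    have hq := hQpos t
    by_contra hc
    push Not at hc
    have h3 : sInf (S t) ≤ r * Q t := csInf_le (hbdd t) ⟨by positivity, hc.le⟩
    rw [← h1] at h3
    nlinarith
  have hratio : ∀ r : ℝ, 0 < r →
      Tendsto (fun t => F (Q t) / F (r * Q t)) (𝓝[>] 0) (𝓝 (r ^ α)) := by
    intro r hr
    have := ((h.rv r hr).comp hQt).inv₀ (by positivity)
    rw [Real.rpow_neg hr.le, inv_inv] at this
    refine this.congr fun t => ?_
    simp [inv_div]
  have hcont : Tendsto (fun r : ℝ => r ^ α) (𝓝 1) (𝓝 1) := by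
    have := (Real.continuousAt_rpow_const 1 α (Or.inr hα.le)).tendsto
    simpa using this
  refine ⟨Q, hQpos, hQt, ?_⟩
  rw [tendsto_order]
  constructor
  · intro a ha
    have h1 : ∀ᶠ r in 𝓝[<] (1:ℝ), a < r ^ α ∧ 0 < r :=
      ((hcont.eventually (lt_mem_nhds ha)).and (lt_mem_nhds one_pos)).filter_mono nhdsWithin_le_nhds
    obtain ⟨r, ⟨hr1, hr2⟩, hr3⟩ := (h1.and eventually_mem_nhdsWithin).exists
    filter_upwards [(hratio r hr2).eventually (lt_mem_nhds hr1), hdn, hpos] with t k1 k2 k3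
    refine k1.trans_le ?_
    exact div_le_div_of_nonneg_left (h.pos _ (hQpos t)).le k3 (k2 r hr2 hr3)
  · intro a ha
    have h1 : ∀ᶠ r in 𝓝[>] (1:ℝ), r ^ α < a ∧ 0 < r :=
      ((hcont.eventually (gt_mem_nhds ha)).and (lt_mem_nhds one_pos)).filter_mono nhdsWithin_le_nhds
    obtain ⟨r, ⟨hr1, hr2⟩, hr3⟩ := (h1.and eventually_mem_nhdsWithin).exists
    filter_upwards [(hratio r hr2).eventually (gt_mem_nhds hr1), hup, hpos] with t k1 k2 k3
    refine lt_of_le_of_lt ?_ k1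
    exact div_le_div_of_nonneg_left (h.pos _ (hQpos t)).le
      (h.pos _ (mul_pos hr2 (hQpos t))) (k2 r hr3)

lemma slow_seq (g : ℕ → ℝ) (hg : Tendsto g atTop atTop) :
    ∃ c : ℕ → ℝ, (∀ n, 0 < c n) ∧ Monotone c ∧ Tendsto c atTop atTop ∧
      Tendsto (fun n => Real.log (c n) / g n) atTop (𝓝 0) := by
  have hb : ∀ n, BddBelow (Set.range fun k => max (g (n + k)) 1) := fun n =>
    ⟨1, by rintro _ ⟨k, rfl⟩; exact le_max_right _ _⟩
  let c : ℕ → ℝ := fun n => ⨅ k, max (g (n + k)) 1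
  have hc1 : ∀ n, 1 ≤ c n := fun n => le_ciInf fun k => le_max_right _ _
  have hct : Tendsto c atTop atTop := by
    rw [tendsto_atTop]
    intro b
    obtain ⟨N, hN⟩ := eventually_atTop.1 (hg.eventually_ge_atTop b)
    filter_upwards [eventually_ge_atTop N] with n hn
    exact le_ciInf fun k => (hN _ (by omega)).trans (le_max_left _ _)
  refine ⟨c, fun n => by linarith [hc1 n], ?_, hct, ?_⟩
  · intro m n hmn
    refine le_ciInf fun k => ?_
    refine (ciInf_le (hb m) (n - m + k)).trans (le_of_eq ?_)
    show max (g (m + (n - m + k))) 1 = _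
    rw [show m + (n - m + k) = n + k by omega]
  · have h1 : Tendsto (fun n => Real.log (c n) / c n) atTop (𝓝 0) :=
      (Real.isLittleO_log_id_atTop.tendsto_div_nhds_zero).comp hct
    refine tendsto_of_tendsto_of_tendsto_of_le_of_le' tendsto_const_nhds h1 ?_ ?_
    · filter_upwards [hg.eventually_ge_atTop 1] with n hn
      exact div_nonneg (Real.log_nonneg (hc1 n)) (by linarith)
    · filter_upwards [hg.eventually_ge_atTop 1] with n hn
      have : c n ≤ g n := by
        have := ciInf_le (hb n) 0
        simpa [hn] using this
      exact div_le_div_of_nonneg_left (Real.log_nonneg (hc1 n)) (by linarith [hc1 n]) this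

universe u

lemma tm_bound {F : ℝ → ℝ} {α p : ℝ} (hα : 0 < α) (h : RV F α) (hp : α < p) :
    ∃ x0 > 0, ∃ C > 0, ∀ {Ω : Type u} [MeasurableSpace Ω] (μ : Measure Ω) [IsProbabilityMeasure μ]
      (Y : Ω → ℝ), Measurable Y → (∀ ω, 0 ≤ Y ω) →
      (∀ x, 0 < x → (μ {ω | x < Y ω}).toReal = F x) →
      ∀ u, x0 ≤ u → ∫ ω, (if Y ω ≤ u then Y ω ^ p else 0) ∂μ ≤ C * (u ^ p * F u) := by
  have hp0 : 0 < p := hα.trans hp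
  set ρ : ℝ := 2 ^ ((p - α) / 2) with hρ
  have hρ1 : 1 < ρ := Real.one_lt_rpow one_lt_two (by linarith)
  have hev : ∀ᶠ x in atTop, (2:ℝ) ^ (-(p + α) / 2) < F (2 * x) / F x :=
    (h.rv 2 two_pos).eventually (lt_mem_nhds
      (Real.rpow_lt_rpow_of_exponent_lt one_lt_two (by linarith)))
  obtain ⟨x0', hx0'⟩ := eventually_atTop.1 hev
  set x0 := max x0' 1 with hx0d
  have hx0 : 0 < x0 := by positivity
  have hF2 := h.pos (2 * x0) (by positivity)
  set C : ℝ := max (2 ^ p / (ρ - 1)) ((2 * x0) ^ p / (x0 ^ p * F (2 * x0))) with hC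
  have hC0 : 0 < C := lt_max_of_lt_left (by have := sub_pos.2 hρ1; positivity)
  refine ⟨x0, hx0, C, hC0, ?_⟩
  intro Ω _ μ _ Y hYm hY0 hYF
  have hint : ∀ u, 0 ≤ u → Integrable (fun ω => if Y ω ≤ u then Y ω ^ p else 0) μ := by
    intro u hu
    refine Integrable.of_bound (C := u ^ p) ?_ ?_
    · exact (Measurable.ite (measurableSet_le hYm measurable_const) (hYm.pow_const p)
        measurable_const).aestronglyMeasurable
    · refine Eventually.of_forall fun ω => ?_
      have := hY0 ω
      split_ifs with h1
      · rw [Real.norm_of_nonneg (by positivity)]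
        exact Real.rpow_le_rpow this h1 hp0.le
      · simp; positivity
  refine dyadic_ind (fun u => ∫ ω, (if Y ω ≤ u then Y ω ^ p else 0) ∂μ ≤ C * (u ^ p * F u))
    x0 hx0 ?_ ?_
  · intro u hu1 hu2
    have hu : 0 < u := by linarith
    have h1 : ∫ ω, (if Y ω ≤ u then Y ω ^ p else 0) ∂μ ≤ ∫ ω, (2 * x0) ^ p ∂μ := by
      refine integral_mono (hint u hu.le) (integrable_const _) fun ω => ?_
      have := hY0 ω
      dsimp only
      split_ifs with h1
      · exact Real.rpow_le_rpow this (by linarith) hp0.le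
      · positivity
    refine h1.trans ?_
    simp only [integral_const, probReal_univ, one_smul]
    have h2 : (2 * x0) ^ p / (x0 ^ p * F (2 * x0)) ≤ C := le_max_right _ _
    rw [div_le_iff₀ (by positivity)] at h2
    refine h2.trans ?_
    gcongr
    exact h.anti _ _ hu hu2
  · intro u hu ih
    have hup : 0 < u := by linarith
    have hFu := h.pos u hup
    have hms : MeasurableSet {ω | u < Y ω} := measurableSet_lt measurable_const hYm
    have h1 : ∫ ω, (if Y ω ≤ 2 * u then Y ω ^ p else 0) ∂μ ≤
        ∫ ω, ((if Y ω ≤ u then Y ω ^ p else 0) + {ω | u < Y ω}.indicator (fun _ => (2 * u) ^ p) ω) ∂μ := by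
      refine integral_mono (hint _ (by positivity))
        ((hint u hup.le).add ((integrable_const _).indicator hms)) fun ω => ?_
      have := hY0 ω
      simp only [Set.indicator, Set.mem_ofPred_eq]
      by_cases ha : Y ω ≤ u
      · rw [if_pos ha, if_pos (by linarith), if_neg (by linarith)]; simp
      · rw [if_neg ha, if_pos (lt_of_not_ge ha)]
        split_ifs with hb
        · simpa using Real.rpow_le_rpow this hb hp0.le
        · simp; positivity
    rw [integral_add (hint u hup.le) ((integrable_const _).indicator hms),
      integral_indicator_const _ hms, measureReal_def, hYF u hup, smul_eq_mul,
      Real.mul_rpow (by norm_num) hup.le] at h1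
    refine h1.trans ?_
    have h3 := hx0' u ((le_max_left _ _).trans hu)
    rw [lt_div_iff₀ hFu] at h3
    have h4 : ρ * (u ^ p * F u) ≤ (2 * u) ^ p * F (2 * u) := by
      rw [Real.mul_rpow (by norm_num) hup.le]
      calc ρ * (u ^ p * F u) = 2 ^ p * u ^ p * (2 ^ (-(p + α) / 2) * F u) := by
            rw [hρ, show (p - α) / 2 = p + -(p + α) / 2 by ring, Real.rpow_add two_pos]; ring
        _ ≤ _ := by gcongr
    have h5 : 2 ^ p / (ρ - 1) ≤ C := le_max_left _ _
    rw [div_le_iff₀ (by linarith)] at h5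
    have hH : 0 < u ^ p * F u := by positivity
    calc _ ≤ C * (u ^ p * F u) + 2 ^ p * (u ^ p * F u) := by linarith
      _ ≤ C * (u ^ p * F u) + (C * (ρ - 1)) * (u ^ p * F u) := by gcongr
      _ = C * (ρ * (u ^ p * F u)) := by ring
      _ ≤ _ := by gcongr

lemma trunc_meas {Ω : Type*} [MeasurableSpace Ω] {Y : Ω → ℝ} (hY : Measurable Y) (v p : ℝ) :
    Measurable (fun ω => trunc Y v ω ^ p) :=
  (Measurable.ite (measurableSet_lt hY measurable_const) hY measurable_const).pow_const p

lemma trunc_nonneg {Ω : Type*} {Y : Ω → ℝ} (hY0 : ∀ ω, 0 ≤ Y ω) (v : ℝ) (ω : Ω) :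
    0 ≤ trunc Y v ω := by
  unfold trunc; split_ifs
  · exact hY0 ω
  · exact le_rfl

lemma trunc_le {Ω : Type*} {Y : Ω → ℝ} {v : ℝ} (hv : 0 < v) (ω : Ω) :
    trunc Y v ω ≤ v := by
  unfold trunc; split_ifs with h
  · exact h.le
  · exact hv.le

lemma trunc_le_self {Ω : Type*} {Y : Ω → ℝ} (hY0 : ∀ ω, 0 ≤ Y ω) (v : ℝ) (ω : Ω) :
    trunc Y v ω ≤ Y ω := by
  unfold trunc; split_ifs with h
  · exact le_rfl
  · exact hY0 ω

lemma trunc_norm {Ω : Type*} {Y : Ω → ℝ} (hY0 : ∀ ω, 0 ≤ Y ω) {v : ℝ} (hv : 0 < v) {p : ℝ}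
    (hp : 0 < p) (ω : Ω) : ‖trunc Y v ω ^ p‖ ≤ v ^ p := by
  have := trunc_nonneg hY0 v ω
  rw [Real.norm_of_nonneg (by positivity)]
  exact Real.rpow_le_rpow this (trunc_le hv ω) hp.le

lemma trunc_memLp {Ω : Type*} [MeasurableSpace Ω] (μ : Measure Ω) [IsProbabilityMeasure μ]
    {Y : Ω → ℝ} (hY : Measurable Y) (hY0 : ∀ ω, 0 ≤ Y ω) {v : ℝ} (hv : 0 < v) {p : ℝ}
    (hp : 0 < p) : MemLp (fun ω => trunc Y v ω ^ p) 2 μ :=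
  MemLp.of_bound (trunc_meas hY v p).aestronglyMeasurable (v ^ p)
    (Eventually.of_forall fun ω => trunc_norm hY0 hv hp ω)

lemma tm_lower {F : ℝ → ℝ} {α p : ℝ} (hα : 0 < α) (h : RV F α) (hp : α < p) :
    ∃ x0 > 0, ∃ C > 0, ∀ {Ω : Type u} [MeasurableSpace Ω] (μ : Measure Ω) [IsProbabilityMeasure μ]
      (Y : Ω → ℝ), Measurable Y → (∀ ω, 0 ≤ Y ω) →
      (∀ x, 0 < x → (μ {ω | x < Y ω}).toReal = F x) →
      ∀ v, x0 ≤ v → C * (v ^ p * F v) ≤ ∫ ω, trunc Y v ω ^ p ∂μ := by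
  have hp0 : 0 < p := hα.trans hp
  set d : ℝ := (1/4) ^ (-α) - (1/2) ^ (-α) with hd
  have hd0 : 0 < d := sub_pos.2 (Real.rpow_lt_rpow_of_neg (by norm_num) (by norm_num) (by linarith))
  have hev : ∀ᶠ x in atTop, d / 2 < F (1/4 * x) / F x - F (1/2 * x) / F x :=
    ((h.rv (1/4) (by norm_num)).sub (h.rv (1/2) (by norm_num))).eventually
      (lt_mem_nhds (by linarith))
  obtain ⟨x0', hx0'⟩ := eventually_atTop.1 hev
  refine ⟨max x0' 1, by positivity, (1/4) ^ p * (d / 2), by positivity, ?_⟩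
  intro Ω _ μ _ Y hYm hY0 hYF v hv
  have hvp : 0 < v := lt_of_lt_of_le one_pos ((le_max_right _ _).trans hv)
  have h1 := hx0' v ((le_max_left _ _).trans hv)
  have hFv := h.pos v hvp
  rw [← sub_div, lt_div_iff₀ hFv] at h1
  set A : Set Ω := {ω | 1/4 * v < Y ω} \ {ω | 1/2 * v < Y ω} with hA
  have hm1 : MeasurableSet {ω | 1/4 * v < Y ω} := measurableSet_lt measurable_const hYm
  have hm2 : MeasurableSet {ω | 1/2 * v < Y ω} := measurableSet_lt measurable_const hYm
  have hAm : MeasurableSet A := hm1.diff hm2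
  have hμA : μ.real A = F (1/4 * v) - F (1/2 * v) := by
    have hss : {ω | 1/2 * v < Y ω} ⊆ {ω | 1/4 * v < Y ω} := by
      intro ω hω
      have hω' : 1/2 * v < Y ω := hω
      show 1/4 * v < Y ω
      linarith
    rw [hA, measureReal_sdiff hss hm2, measureReal_def, measureReal_def, hYF _ (by positivity),
      hYF _ (by positivity)]
  have h2 : ∫ ω, A.indicator (fun _ => (1/4 * v) ^ p) ω ∂μ ≤ ∫ ω, trunc Y v ω ^ p ∂μ := by
    refine integral_mono ((integrable_const _).indicator hAm)
      ((trunc_memLp μ hYm hY0 hvp hp0).integrable one_le_two) fun ω => ?_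
    have h0 := trunc_nonneg hY0 v ω
    by_cases hω : ω ∈ A
    · rw [Set.indicator_of_mem hω]
      have ha : 1/4 * v < Y ω := hω.1
      have hb : ¬ (1/2 * v < Y ω) := hω.2
      have : trunc Y v ω = Y ω := by unfold trunc; rw [if_pos (by linarith)]
      dsimp only
      rw [this]
      exact Real.rpow_le_rpow (by positivity) ha.le hp0.le
    · rw [Set.indicator_of_notMem hω]; positivity
  rw [integral_indicator_const _ hAm, hμA, smul_eq_mul, Real.mul_rpow (by norm_num) hvp.le] at h2
  refine le_trans ?_ h2
  have hvv : 0 < (1/4:ℝ) ^ p * v ^ p := by positivity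
  calc _ = (d / 2 * F v) * ((1/4:ℝ) ^ p * v ^ p) := by ring
    _ ≤ _ := by gcongr

lemma cheb {Ω : Type*} [MeasurableSpace Ω] (μ : Measure Ω) [IsProbabilityMeasure μ]
    (X : ℕ → Ω → ℝ) (hXm : ∀ i, Measurable (X i)) (hX0 : ∀ i ω, 0 ≤ X i ω)
    (v : ℕ → ℝ) (p : ℝ) (hp : 0 < p) (n : ℕ) (hn : 0 < n) (hv : 0 < v n) (m q : ℝ) (hm : 0 < m)
    (hmean : ∀ i, m ≤ ∫ ω, trunc (X i) (v n) ω ^ p ∂μ)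
    (hsq : ∀ i, ∫ ω, trunc (X i) (v n) ω ^ (2 * p) ∂μ ≤ q) :
    (μ {ω | ∑ i ∈ Finset.range n, X i ω ^ p ≤ n * m / 2}).toReal ≤
      (n * q + covSum μ X v p n) / (n * m / 2) ^ 2 := by
  have hn' : (0:ℝ) < n := by exact_mod_cast hn
  set Y : ℕ → Ω → ℝ := fun i ω => trunc (X i) (v n) ω ^ p with hY
  have hL : ∀ i, MemLp (Y i) 2 μ := fun i => trunc_memLp μ (hXm i) (hX0 i) hv hp
  have hLs : MemLp (∑ i ∈ Finset.range n, Y i) 2 μ := memLp_finsetSum' _ fun i _ => hL i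
  have hcov : ∀ i j, ProbabilityTheory.covariance (Y i) (Y j) μ = cov μ (Y i) (Y j) := by
    intro i j
    rw [ProbabilityTheory.covariance_eq_sub (hL i) (hL j)]
    rfl
  have hvar : ProbabilityTheory.variance (∑ i ∈ Finset.range n, Y i) μ ≤
      n * q + covSum μ X v p n := by
    rw [ProbabilityTheory.variance_sum' (fun i _ => hL i)]
    have : (n:ℝ) * q = ∑ i ∈ Finset.range n, q := by simp
    rw [this, covSum, ← Finset.sum_add_distrib]
    refine Finset.sum_le_sum fun i hi => ?_
    have h1 : ∀ j, ProbabilityTheory.covariance (Y i) (Y j) μ =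
        (if i = j then ProbabilityTheory.covariance (Y i) (Y j) μ else 0) +
        (if i = j then 0 else cov μ (Y i) (Y j)) := by
      intro j
      split_ifs
      · simp
      · simp [hcov]
    rw [Finset.sum_congr rfl fun j _ => h1 j, Finset.sum_add_distrib, Finset.sum_ite_eq, if_pos hi]
    refine add_le_add ?_ le_rfl
    rw [hcov, cov]
    have h2 : ∫ ω, Y i ω * Y i ω ∂μ = ∫ ω, trunc (X i) (v n) ω ^ (2 * p) ∂μ := by
      refine integral_congr_ae (Eventually.of_forall fun ω => ?_)
      have h0 := trunc_nonneg (hX0 i) (v n) ω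
      simp only [hY]
      rw [two_mul, Real.rpow_add_of_nonneg h0 hp.le hp.le]
    rw [h2]
    have := hsq i
    nlinarith [mul_self_nonneg (∫ ω, Y i ω ∂μ)]
  have hE : n * m ≤ ∫ ω, (∑ i ∈ Finset.range n, Y i) ω ∂μ := by
    simp only [Finset.sum_apply]
    rw [integral_finsetSum _ fun i _ => (hL i).integrable one_le_two]
    calc (n:ℝ) * m = ∑ i ∈ Finset.range n, m := by simp
      _ ≤ _ := Finset.sum_le_sum fun i _ => hmean i
  have hc : 0 < n * m / 2 := by positivity
  have hch := ProbabilityTheory.meas_ge_le_variance_div_sq hLs hc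
  have hv0 := ProbabilityTheory.variance_nonneg (∑ i ∈ Finset.range n, Y i) μ
  refine ENNReal.toReal_le_of_le_ofReal (by have := hv0.trans hvar; positivity) ?_
  refine (measure_mono ?_).trans (hch.trans (ENNReal.ofReal_le_ofReal (by gcongr)))
  intro ω hω
  simp only [Set.mem_ofPred_eq] at hω ⊢
  have h3 : (∑ i ∈ Finset.range n, Y i) ω ≤ ∑ i ∈ Finset.range n, X i ω ^ p := by
    rw [Finset.sum_apply]
    refine Finset.sum_le_sum fun i _ => ?_
    exact Real.rpow_le_rpow (trunc_nonneg (hX0 i) _ ω) (trunc_le_self (hX0 i) _ ω) hp.le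
  rw [abs_sub_comm]
  refine le_trans ?_ (le_abs_self _)
  linarith

lemma lower_prob {Ω : Type*} [MeasurableSpace Ω] (μ : Measure Ω) [IsProbabilityMeasure μ]
    (X : ℕ → Ω → ℝ) (hXm : ∀ i, Measurable (X i)) (hX0 : ∀ i ω, 0 ≤ X i ω)
    {F : ℝ → ℝ} {α p : ℝ} (hα : 0 < α) (h : RV F α) (hp : α < p)
    (hXF : ∀ i, ∀ x, 0 < x → (μ {ω | x < X i ω}).toReal = F x)
    (c v : ℕ → ℝ) (hc0 : ∀ n, 0 < c n) (hc : Tendsto c atTop atTop) (hv0 : ∀ n, 0 < v n)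
    (hv : Tendsto v atTop atTop) (hr : Tendsto (fun n => n * F (v n) / c n) atTop (𝓝 1))
    (hA : ConditionA μ X v c p) :
    ∃ k > 0, Tendsto (fun n => (μ {ω | ∑ i ∈ Finset.range n, X i ω ^ p ≤ k * (v n ^ p * c n)}).toReal)
      atTop (𝓝 0) := by
  have hp0 : 0 < p := hα.trans hp
  obtain ⟨x1, hx1, C, hC, H1⟩ := tm_bound (p := 2 * p) hα h (by linarith)
  obtain ⟨x2, hx2, k, hk, H2⟩ := tm_lower hα h hp
  refine ⟨k / 4, by positivity, ?_⟩
  set r : ℕ → ℝ := fun n => n * F (v n) / c n with hrd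
  have hlim : Tendsto (fun n => (4 / k ^ 2) * (C * (r n)⁻¹ * (c n)⁻¹ +
      covSum μ X v p n / (v n ^ (2 * p) * c n ^ 2) * ((r n)⁻¹) ^ 2)) atTop (𝓝 0) := by
    have e1 := hr.inv₀ one_ne_zero
    have e2 := (((e1.const_mul C).mul hc.inv_tendsto_atTop).add
      (hA.mul (e1.pow 2))).const_mul (4 / k ^ 2)
    simpa using e2
  refine tendsto_of_tendsto_of_tendsto_of_le_of_le' tendsto_const_nhds hlim
    (Eventually.of_forall fun n => ENNReal.toReal_nonneg) ?_
  filter_upwards [hv.eventually_ge_atTop x1, hv.eventually_ge_atTop x2, eventually_gt_atTop 0,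
    hr.eventually (lt_mem_nhds (show (1/2:ℝ) < 1 by norm_num))] with n hn1 hn2 hn hrn
  have hvn := hv0 n
  have hcn := hc0 n
  have hFn := h.pos _ hvn
  have hn' : (0:ℝ) < n := by exact_mod_cast hn
  have hch := cheb μ X hXm hX0 v p hp0 n hn hvn (k * (v n ^ p * F (v n)))
    (C * (v n ^ (2 * p) * F (v n))) (by positivity)
    (fun i => H2 μ (X i) (hXm i) (hX0 i) (hXF i) _ hn2)
    (fun i => by
      refine le_trans ?_ (H1 μ (X i) (hXm i) (hX0 i) (hXF i) _ hn1)
      refine integral_mono ((trunc_memLp μ (hXm i) (hX0 i) hvn (by positivity)).integrable one_le_two)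
        ?_ fun ω => ?_
      · refine Integrable.of_bound (C := v n ^ (2 * p)) ?_ ?_
        · exact (Measurable.ite (measurableSet_le (hXm i) measurable_const) ((hXm i).pow_const _)
            measurable_const).aestronglyMeasurable
        · refine Eventually.of_forall fun ω => ?_
          have := hX0 i ω
          split_ifs with h1
          · rw [Real.norm_of_nonneg (by positivity)]
            exact Real.rpow_le_rpow this h1 (by positivity)
          · simp; positivity
      · have := hX0 i ω
        simp only [trunc]
        split_ifs with ha hb hb
        · exact le_rfl
        · exact absurd ha.le hb
        · rw [Real.zero_rpow (by positivity)]; positivity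
        · rw [Real.zero_rpow (by positivity)])
  have hrc : (n:ℝ) * F (v n) = r n * c n := by rw [hrd]; field_simp
  have hrpos : 0 < r n := by linarith [show (1/2:ℝ) < r n from hrn]
  have hrn' : (1/2:ℝ) < r n := hrn
  refine le_trans ?_ (hch.trans (le_of_eq ?_))
  · refine ENNReal.toReal_mono (measure_ne_top _ _) (measure_mono fun ω hω => ?_)
    simp only [Set.mem_ofPred_eq] at hω ⊢
    refine hω.trans ?_
    calc k / 4 * (v n ^ p * c n) = k / 2 * v n ^ p * (1/2 * c n) := by ring
      _ ≤ k / 2 * v n ^ p * (r n * c n) := by gcongr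
      _ = _ := by rw [← hrc]; ring
  · have e1 : (n:ℝ) * (C * (v n ^ (2 * p) * F (v n))) = C * v n ^ (2 * p) * (r n * c n) := by
      rw [← hrc]; ring
    have e2 : (n:ℝ) * (k * (v n ^ p * F (v n))) / 2 = k / 2 * v n ^ p * (r n * c n) := by
      rw [← hrc]; ring
    rw [e1, e2]
    have e3 : v n ^ (2 * p) = (v n ^ p) ^ 2 := by
      rw [mul_comm, Real.rpow_mul hvn.le]; norm_num
    rw [e3]
    field_simp
    try ring

lemma upper_prob {Ω : Type*} [MeasurableSpace Ω] (μ : Measure Ω) [IsProbabilityMeasure μ]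
    (X : ℕ → Ω → ℝ) (hXm : ∀ i, Measurable (X i)) (hX0 : ∀ i ω, 0 ≤ X i ω)
    {F : ℝ → ℝ} {α p : ℝ} (hα : 0 < α) (h : RV F α) (hp : α < p)
    (hXF : ∀ i, ∀ x, 0 < x → (μ {ω | x < X i ω}).toReal = F x)
    (c u : ℕ → ℝ) (hc0 : ∀ n, 0 < c n) (hc : Tendsto c atTop atTop) (hu0 : ∀ n, 0 < u n)
    (hu : Tendsto u atTop atTop) (hr : Tendsto (fun n => n * F (u n)) atTop (𝓝 0)) :
    Tendsto (fun n => (μ {ω | u n ^ p * c n ≤ ∑ i ∈ Finset.range n, X i ω ^ p}).toReal)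
      atTop (𝓝 0) := by
  have hp0 : 0 < p := hα.trans hp
  obtain ⟨x1, hx1, C, hC, H1⟩ := tm_bound hα h hp
  have hlim : Tendsto (fun n => n * F (u n) + C * (n * F (u n)) * (c n)⁻¹) atTop (𝓝 0) := by
    simpa using hr.add ((hr.const_mul C).mul hc.inv_tendsto_atTop)
  refine tendsto_of_tendsto_of_tendsto_of_le_of_le' tendsto_const_nhds hlim
    (Eventually.of_forall fun n => ENNReal.toReal_nonneg) ?_
  filter_upwards [hu.eventually_ge_atTop x1] with n hn1
  have hun := hu0 n
  have hcn := hc0 n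
  set Y : ℕ → Ω → ℝ := fun i ω => if X i ω ≤ u n then X i ω ^ p else 0 with hY
  have hY0 : ∀ i ω, 0 ≤ Y i ω := by
    intro i ω
    have := hX0 i ω
    simp only [hY]; split_ifs <;> positivity
  have hYi : ∀ i, Integrable (Y i) μ := by
    intro i
    refine Integrable.of_bound (C := u n ^ p) ?_ ?_
    · exact (Measurable.ite (measurableSet_le (hXm i) measurable_const) ((hXm i).pow_const _)
        measurable_const).aestronglyMeasurable
    · refine Eventually.of_forall fun ω => ?_
      have := hX0 i ω
      simp only [hY]
      split_ifs with h1
      · rw [Real.norm_of_nonneg (by positivity)]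
        exact Real.rpow_le_rpow this h1 (by positivity)
      · simp; positivity
  have hsub : {ω | u n ^ p * c n ≤ ∑ i ∈ Finset.range n, X i ω ^ p} ⊆
      (⋃ i ∈ Finset.range n, {ω | u n < X i ω}) ∪
        {ω | u n ^ p * c n ≤ ∑ i ∈ Finset.range n, Y i ω} := by
    intro ω hω
    by_cases hex : ∃ i ∈ Finset.range n, u n < X i ω
    · left; simpa using hex
    · right
      push Not at hex
      have : ∑ i ∈ Finset.range n, Y i ω = ∑ i ∈ Finset.range n, X i ω ^ p :=
        Finset.sum_congr rfl fun i hi => by simp only [hY]; rw [if_pos (hex i hi)]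
      simp only [Set.mem_ofPred_eq, this]
      exact hω
  have hK : 0 < u n ^ p * c n := by positivity
  have hmk : μ.real {ω | u n ^ p * c n ≤ ∑ i ∈ Finset.range n, Y i ω} ≤
      C * (n * F (u n)) * (c n)⁻¹ := by
    have h1 := mul_meas_ge_le_integral_of_nonneg (μ := μ)
      (f := fun ω => ∑ i ∈ Finset.range n, Y i ω)
      (Eventually.of_forall fun ω => Finset.sum_nonneg fun i _ => hY0 i ω)
      (integrable_finsetSum _ fun i _ => hYi i) (u n ^ p * c n)
    rw [integral_finsetSum _ fun i _ => hYi i] at h1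
    have h2 : ∑ i ∈ Finset.range n, ∫ ω, Y i ω ∂μ ≤ ∑ i ∈ Finset.range n, C * (u n ^ p * F (u n)) :=
      Finset.sum_le_sum fun i _ => H1 μ (X i) (hXm i) (hX0 i) (hXF i) _ hn1
    simp only [Finset.sum_const, Finset.card_range, nsmul_eq_mul] at h2
    have h3 := h1.trans h2
    rw [mul_comm, ← le_div_iff₀ hK] at h3
    refine h3.trans (le_of_eq ?_)
    field_simp
  have hun2 : μ.real (⋃ i ∈ Finset.range n, {ω | u n < X i ω}) ≤ n * F (u n) := by
    refine (measureReal_biUnion_finset_le _ _).trans ?_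
    simp only [measureReal_def, hXF _ _ hun]
    simp
  calc _ ≤ μ.real ((⋃ i ∈ Finset.range n, {ω | u n < X i ω}) ∪
        {ω | u n ^ p * c n ≤ ∑ i ∈ Finset.range n, Y i ω}) := measureReal_mono hsub
    _ ≤ _ := measureReal_union_le _ _
    _ ≤ _ := add_le_add hun2 hmk

lemma det_ratio (α h₁ h₂ : ℝ) (hα : 0 < α) (hh₁ : α < h₁) (hh₂ : α < h₂) :
    ∃ η > 0, ∃ C > 0, ∀ N L A₁ A₂ : ℝ, 0 < N → L ≠ 0 → |L| ≤ η * N →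
      |A₁ - ((h₁ - α) / α * N + h₁ / α * L)| ≤ η * |L| →
      |A₂ - ((h₂ - α) / α * N + h₂ / α * L)| ≤ η * |L| → (h₁ = h₂ → A₁ = A₂) →
      |A₁ / A₂ - (h₁ - α) / (h₂ - α)| ≤ C * (|L| / N) ∧
      |(A₁ / A₂ - (h₁ - α) / (h₂ - α))⁻¹| ≤ C * (N / |L|) := by
  have ha1 : 0 < h₁ - α := by linarith
  have ha2 : 0 < h₂ - α := by linarith
  have hh2 : 0 < h₂ := by linarith
  set η₀ := min 1 ((h₂ - α) / (2 * (h₂ + α))) with hη₀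
  have hη₀p : 0 < η₀ := by positivity
  have hA2 : ∀ η N L A₂ : ℝ, 0 < η → η ≤ η₀ → 0 < N → |L| ≤ η * N →
      |A₂ - ((h₂ - α) / α * N + h₂ / α * L)| ≤ η * |L| →
      (h₂ - α) / (2 * α) * N ≤ A₂ ∧ A₂ ≤ 2 * (h₂ - α) / α * N := by
    intro η N L A₂ hη hηη hN hL hA
    have e1 : η ≤ 1 := hηη.trans (min_le_left _ _)
    have e2 : η ≤ (h₂ - α) / (2 * (h₂ + α)) := hηη.trans (min_le_right _ _)
    rw [le_div_iff₀ (by positivity)] at e2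
    have e3 : η * |L| ≤ η * N := (mul_le_of_le_one_left (abs_nonneg _) e1).trans hL
    have e4 : |h₂ / α * L| ≤ h₂ / α * (η * N) := by
      rw [abs_mul, abs_of_pos (by positivity : 0 < h₂ / α)]; gcongr
    have e5 : h₂ / α * (η * N) + η * N ≤ (h₂ - α) / (2 * α) * N := by
      have : h₂ / α * (η * N) + η * N = (η * (2 * (h₂ + α))) / (2 * α) * N := by
        field_simp
      rw [this]; gcongr
    have e6 : (h₂ - α) / α * N = 2 * ((h₂ - α) / (2 * α) * N) := by field_simp
    have e7 : 2 * (h₂ - α) / α * N = 4 * ((h₂ - α) / (2 * α) * N) := by field_simp; ring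
    have e8 : 0 < (h₂ - α) / (2 * α) * N := by positivity
    rw [abs_le] at hA e4
    rw [e7]
    rw [e6] at hA
    constructor <;> linarith [hA.1, hA.2, e4.1, e4.2]
  by_cases heq : h₁ = h₂
  · refine ⟨η₀, hη₀p, 1, one_pos, ?_⟩
    intro N L A₁ A₂ hN hL0 hL h1 h2 h3
    have hb := hA2 η₀ N L A₂ hη₀p le_rfl hN hL h2
    have hpos : 0 < A₂ := lt_of_lt_of_le (by positivity) hb.1
    have : A₁ / A₂ - (h₁ - α) / (h₂ - α) = 0 := by
      rw [h3 heq, heq, div_self hpos.ne', div_self ha2.ne', sub_self]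
    rw [this]
    simp only [inv_zero, abs_zero]
    constructor <;> positivity
  · have hd : 0 < |h₂ - h₁| := abs_pos.2 (sub_ne_zero.2 (Ne.symm heq))
    set η := min η₀ (|h₂ - h₁| / (2 * (h₁ - α + (h₂ - α)))) with hη
    have hs : 0 < h₁ - α + (h₂ - α) := by linarith
    have hηp : 0 < η := by positivity
    have hηd : η * (h₁ - α + (h₂ - α)) ≤ |h₂ - h₁| / 2 := by
      have : η ≤ |h₂ - h₁| / (2 * (h₁ - α + (h₂ - α))) := min_le_right _ _
      rw [le_div_iff₀ (by positivity)] at this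
      linarith
    set C1 := 2 * |h₂ - h₁| / ((h₂ - α) / (2 * α) * (h₂ - α)) with hC1
    set C2 := (2 * (h₂ - α) / α * (h₂ - α)) / (|h₂ - h₁| / 2) with hC2
    have hC1p : 0 < C1 := by positivity
    have hC2p : 0 < C2 := by positivity
    refine ⟨η, hηp, max C1 C2, lt_max_of_lt_left hC1p, ?_⟩
    intro N L A₁ A₂ hN hL0 hL h1 h2 _
    have hLp : 0 < |L| := abs_pos.2 hL0
    obtain ⟨hb1, hb2⟩ := hA2 η N L A₂ hηp (min_le_left _ _) hN hL h2
    have hpos : 0 < A₂ := lt_of_lt_of_le (by positivity) hb1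
    set D := A₁ * (h₂ - α) - A₂ * (h₁ - α) with hD
    have hR : A₁ / A₂ - (h₁ - α) / (h₂ - α) = D / (A₂ * (h₂ - α)) := by
      rw [div_sub_div _ _ hpos.ne' ha2.ne']
    have hD1 : |D - L * (h₂ - h₁)| ≤ |h₂ - h₁| / 2 * |L| := by
      set E1 := A₁ - ((h₁ - α) / α * N + h₁ / α * L) with hE1
      set E2 := A₂ - ((h₂ - α) / α * N + h₂ / α * L) with hE2
      have : D - L * (h₂ - h₁) = E1 * (h₂ - α) - E2 * (h₁ - α) := by
        rw [hD, hE1, hE2]; field_simp; ring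
      rw [this]
      calc _ ≤ |E1 * (h₂ - α)| + |E2 * (h₁ - α)| := abs_sub _ _
        _ = |E1| * (h₂ - α) + |E2| * (h₁ - α) := by
            rw [abs_mul, abs_mul, abs_of_pos ha1, abs_of_pos ha2]
        _ ≤ η * |L| * (h₂ - α) + η * |L| * (h₁ - α) := by gcongr
        _ = η * (h₁ - α + (h₂ - α)) * |L| := by ring
        _ ≤ _ := by gcongr
    have hLd : |L * (h₂ - h₁)| = |h₂ - h₁| * |L| := by rw [abs_mul, mul_comm]
    have hDu : |D| ≤ 2 * |h₂ - h₁| * |L| := by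
      have := abs_sub_abs_le_abs_sub D (L * (h₂ - h₁))
      have : 0 < |h₂ - h₁| * |L| := by positivity
      linarith
    have hDl : |h₂ - h₁| / 2 * |L| ≤ |D| := by
      have := abs_sub_abs_le_abs_sub (L * (h₂ - h₁)) D
      rw [abs_sub_comm (L * (h₂ - h₁)) D] at this
      linarith
    have hden : 0 < A₂ * (h₂ - α) := by positivity
    rw [hR]
    constructor
    · rw [abs_div, abs_of_pos hden]
      calc |D| / (A₂ * (h₂ - α)) ≤ 2 * |h₂ - h₁| * |L| / ((h₂ - α) / (2 * α) * N * (h₂ - α)) := by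
            gcongr
        _ = C1 * (|L| / N) := by rw [hC1]; field_simp
        _ ≤ _ := by gcongr; exact le_max_left _ _
    · rw [inv_div, abs_div, abs_of_pos hden]
      calc A₂ * (h₂ - α) / |D| ≤ 2 * (h₂ - α) / α * N * (h₂ - α) / (|h₂ - h₁| / 2 * |L|) := by
            gcongr
        _ = C2 * (N / |L|) := by rw [hC2]; field_simp
        _ ≤ _ := by gcongr; exact le_max_right _ _

/-- basic relation for the quantile sequence -/
lemma b_log {F : ℝ → ℝ} {α : ℝ} (h : RV F α) (b : ℕ → ℝ) (hb0 : ∀ n, 0 < b n)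
    (hr : Tendsto (fun n : ℕ => n * F (b n)) atTop (𝓝 1)) :
    ∀ᶠ n : ℕ in atTop, |α * Real.log (b n) - Real.log n - Real.log (b n ^ α * F (b n))| ≤ 1 := by
  have h1 : Tendsto (fun n : ℕ => Real.log (n * F (b n))) atTop (𝓝 0) := by
    have := (Real.continuousAt_log one_ne_zero).tendsto.comp hr
    simpa [Function.comp_def] using this
  have h2 := h1.abs
  rw [abs_zero] at h2
  filter_upwards [h2.eventually (gt_mem_nhds one_pos), eventually_gt_atTop 0] with n hn hn0
  have hn' : (0:ℝ) < n := by exact_mod_cast hn0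
  have hb := hb0 n
  have hF := h.pos _ hb
  rw [Real.log_mul hn'.ne' hF.ne', ] at hn
  rw [Real.log_mul (by positivity) hF.ne', Real.log_rpow hb]
  rw [show α * Real.log (b n) - Real.log n - (α * Real.log (b n) + Real.log (F (b n))) =
    -(Real.log n + Real.log (F (b n))) by ring, abs_neg]
  exact hn.le

lemma L_small {F : ℝ → ℝ} {α : ℝ} (hα : 0 < α) (h : RV F α) (b : ℕ → ℝ) (hb0 : ∀ n, 0 < b n)
    (hb : Tendsto b atTop atTop) (hr : Tendsto (fun n : ℕ => n * F (b n)) atTop (𝓝 1))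
    (η : ℝ) (hη : 0 < η) :
    ∀ᶠ n : ℕ in atTop, |Real.log (b n ^ α * F (b n))| ≤ η * Real.log n := by
  set e := min (α / 2) (η * (α / 4)) with he
  have he0 : 0 < e := by positivity
  have hlogn : Tendsto (fun n : ℕ => Real.log n) atTop atTop :=
    Real.tendsto_log_atTop.comp tendsto_natCast_atTop_atTop
  filter_upwards [b_log h b hb0 hr, hb.eventually (log_rv hα h e he0),
    hlogn.eventually_ge_atTop 1, (Real.tendsto_log_atTop.comp hb).eventually_ge_atTop 0]
    with n h1 h2 h3 h4
  have h4' : 0 ≤ Real.log (b n) := h4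
  have e1 : e ≤ α / 2 := min_le_left _ _
  have e2 : e ≤ η * (α / 4) := min_le_right _ _
  have h5 : e * Real.log (b n) ≤ α / 2 * Real.log (b n) := by gcongr
  have h6 := abs_le.1 h1
  have h7 := abs_le.1 h2
  have h8 : α / 4 * Real.log (b n) ≤ Real.log n := by linarith [h6.2, h7.2]
  calc _ ≤ e * Real.log (b n) := h2
    _ ≤ η * (α / 4) * Real.log (b n) := by gcongr
    _ = η * (α / 4 * Real.log (b n)) := by ring
    _ ≤ _ := by gcongr

lemma moment_log {Ω : Type*} [MeasurableSpace Ω] (μ : Measure Ω) [IsProbabilityMeasure μ]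
    (X : ℕ → Ω → ℝ) (hXm : ∀ i, Measurable (X i)) (hX0 : ∀ i ω, 0 ≤ X i ω)
    {F : ℝ → ℝ} {α p : ℝ} (hα : 0 < α) (h : RV F α) (hp : α < p)
    (hXF : ∀ i, ∀ x, 0 < x → (μ {ω | x < X i ω}).toReal = F x)
    (c v b : ℕ → ℝ) (hc0 : ∀ n, 0 < c n) (hc : Tendsto c atTop atTop) (hv0 : ∀ n, 0 < v n)
    (hv : Tendsto v atTop atTop) (hr : Tendsto (fun n => n * F (v n) / c n) atTop (𝓝 1))
    (hb0 : ∀ n, 0 < b n) (hb : Tendsto b atTop atTop)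
    (hrb : Tendsto (fun n : ℕ => n * F (b n)) atTop (𝓝 1))
    (hL : Tendsto (fun n => |Real.log (b n ^ α * F (b n))|) atTop atTop)
    (hcL : Tendsto (fun n => Real.log (c n) / |Real.log (b n ^ α * F (b n))|) atTop (𝓝 0))
    (hA : ConditionA μ X v c p) (η : ℝ) (hη : 0 < η) :
    Tendsto (fun n : ℕ => (μ {ω | ¬ |Real.log (sampleMoment X p n ω) -
      ((p - α) / α * Real.log n + p / α * Real.log (b n ^ α * F (b n)))| ≤
        η * |Real.log (b n ^ α * F (b n))|}).toReal) atTop (𝓝 0) := by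
  have hp0 : 0 < p := hα.trans hp
  obtain ⟨x0, hx0, A, hAp, HA⟩ := potter_upper h (β := α / 2) (by linarith) (by linarith)
  have hu0 : ∀ n, 0 < b n * c n := fun n => mul_pos (hb0 n) (hc0 n)
  have hnu : Tendsto (fun n : ℕ => n * F (b n * c n)) atTop (𝓝 0) := by
    have h1 : Tendsto (fun n : ℕ => A * (c n) ^ (-(α/2)) * (n * F (b n))) atTop (𝓝 0) := by
      have := (tendsto_rpow_neg_atTop (y := α / 2) (by linarith)).comp hc
      simpa using (this.const_mul A).mul hrb
    refine tendsto_of_tendsto_of_tendsto_of_le_of_le' tendsto_const_nhds h1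
      (Eventually.of_forall fun n => mul_nonneg (Nat.cast_nonneg n) (h.pos _ (hu0 n)).le) ?_
    filter_upwards [hc.eventually_ge_atTop 1, hb.eventually_ge_atTop x0] with n h2 h3
    have := HA (b n) h3 (c n) h2
    rw [mul_comm (c n)] at this
    calc (n:ℝ) * F (b n * c n) ≤ n * (A * c n ^ (-(α/2)) * F (b n)) := by gcongr
      _ = _ := by ring
  have hup := upper_prob μ X hXm hX0 hα h hp hXF c (fun n => b n * c n) hc0 hc hu0
    (hb.atTop_mul_atTop₀ hc) hnu
  obtain ⟨k, hk, hlow⟩ := lower_prob μ X hXm hX0 hα h hp hXF c v hc0 hc hv0 hv hr hA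
  have hsum := hup.add hlow
  rw [add_zero] at hsum
  have hlogc : Tendsto (fun n => Real.log (c n)) atTop atTop := Real.tendsto_log_atTop.comp hc
  set K := p + 1 + 4 * p / α + p / α with hK
  have hKp : 0 < K := by positivity
  refine tendsto_of_tendsto_of_tendsto_of_le_of_le' tendsto_const_nhds hsum
    (Eventually.of_forall fun n => ENNReal.toReal_nonneg) ?_
  filter_upwards [eventually_gt_atTop 0, b_log h b hb0 hrb, hlogc.eventually_ge_atTop 1,
    hlogc.eventually_ge_atTop (Real.log (4 * A)), hlogc.eventually_ge_atTop (-Real.log k),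
    hcL.eventually (gt_mem_nhds (show 0 < η / K by positivity)), hL.eventually_gt_atTop 0,
    hr.eventually (gt_mem_nhds (show (1:ℝ) < 2 by norm_num)),
    hrb.eventually (lt_mem_nhds (show (1/2:ℝ) < 1 by norm_num)),
    hv.eventually_ge_atTop x0] with n hn hbl hc1 hc4 hck hcl hLn hrn hrbn hvx
  have hn' : (0:ℝ) < n := by exact_mod_cast hn
  have hbn := hb0 n
  have hcn := hc0 n
  have hvn := hv0 n
  have hFb := h.pos _ hbn
  have hFv := h.pos _ hvn
  set L := Real.log (b n ^ α * F (b n)) with hLdef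
  have hcL' : K * Real.log (c n) ≤ η * |L| := by
    rw [div_lt_iff₀ hLn, div_mul_eq_mul_div, lt_div_iff₀ hKp] at hcl
    linarith
  -- log v ≥ log b - (4/α) log c
  have hvb : Real.log (b n) - 4 / α * Real.log (c n) ≤ Real.log (v n) := by
    by_cases hbv : b n ≤ v n
    · have := Real.log_le_log hbn hbv
      have : 0 ≤ 4 / α * Real.log (c n) := by positivity
      linarith
    · push Not at hbv
      have h1 := HA (v n) hvx (b n / v n) (by rw [le_div_iff₀ hvn]; linarith)
      rw [div_mul_cancel₀ _ hvn.ne'] at h1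
      rw [div_lt_iff₀ hcn] at hrn
      have h2 : 1 ≤ (4 * A) * (b n / v n) ^ (-(α/2)) * c n := by
        have h3 : (n:ℝ) * F (b n) ≤ n * (A * (b n / v n) ^ (-(α / 2)) * F (v n)) := by gcongr
        have h4 : (n:ℝ) * (A * (b n / v n) ^ (-(α / 2)) * F (v n)) ≤
            A * (b n / v n) ^ (-(α / 2)) * (2 * c n) := by
          calc _ = A * (b n / v n) ^ (-(α / 2)) * (n * F (v n)) := by ring
            _ ≤ _ := by gcongr
        linarith
      have h5 := Real.log_le_log one_pos h2
      rw [Real.log_one, Real.log_mul (by positivity) hcn.ne', Real.log_mul (by positivity)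
        (by positivity), Real.log_rpow (by positivity), Real.log_div hbn.ne' hvn.ne'] at h5
      have h6 : α / 2 * (Real.log (b n) - Real.log (v n)) ≤ 2 * Real.log (c n) := by linarith
      have h7 : Real.log (b n) - Real.log (v n) ≤ 4 / α * Real.log (c n) := by
        rw [div_mul_eq_mul_div, le_div_iff₀ hα]; linarith
      linarith
  refine le_trans ?_ (measureReal_union_le (μ := μ) _ _)
  refine measureReal_mono fun ω hω => ?_
  by_contra hcon
  apply hω
  simp only [Set.mem_union, Set.mem_ofPred_eq, not_or, not_le] at hcon
  obtain ⟨g1, g2⟩ := hcon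
  set S := ∑ i ∈ Finset.range n, X i ω ^ p with hS
  have hS0 : 0 < S := lt_trans (by positivity) g2
  have hM : Real.log (sampleMoment X p n ω) = Real.log S - Real.log n := by
    unfold sampleMoment
    rw [Real.log_mul (by positivity) hS0.ne', Real.log_inv]; ring
  have l1 := Real.log_le_log hS0 g1.le
  have l2 := Real.log_le_log (by positivity) g2.le
  rw [Real.log_mul (by positivity) hcn.ne', Real.log_rpow (by positivity),
    Real.log_mul hbn.ne' hcn.ne'] at l1
  rw [Real.log_mul hk.ne' (by positivity), Real.log_mul (by positivity) hcn.ne',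
    Real.log_rpow hvn] at l2
  have l3 : p * (Real.log (b n) - 4 / α * Real.log (c n)) ≤ p * Real.log (v n) := by gcongr
  set e := α * Real.log (b n) - Real.log n - L with he
  have hbe : p * Real.log (b n) = p / α * (Real.log n + L + e) := by
    rw [he]; field_simp; ring
  have hel : |p / α * e| ≤ p / α * Real.log (c n) := by
    rw [abs_mul, abs_of_pos (by positivity : 0 < p / α)]
    gcongr
    linarith
  rw [abs_le] at hel
  refine le_trans ?_ hcL'
  rw [hM]
  have hid : Real.log S - Real.log n - ((p - α) / α * Real.log n + p / α * L) =
      Real.log S - p * Real.log (b n) + p / α * e := by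
    rw [hbe]; field_simp; ring
  rw [hid, hK, abs_le]
  have hpc : 0 ≤ p * Real.log (c n) := by positivity
  have hpc2 : 0 ≤ p / α * Real.log (c n) := by positivity
  have hpc3 : p * (4 / α * Real.log (c n)) = 4 * (p / α * Real.log (c n)) := by ring
  have hpc4 : (p + 1 + 4 * p / α + p / α) * Real.log (c n) =
    p * Real.log (c n) + Real.log (c n) + 5 * (p / α * Real.log (c n)) := by ring
  rw [hpc4]
  rw [mul_sub, hpc3] at l3
  rw [mul_add] at l1
  constructor <;> linarith [hel.1, hel.2]

lemma l_bounds {F l : ℝ → ℝ} {α : ℝ} (hα : 0 < α) (h : RV F α)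
    (hlF : ∀ x, 0 < x → l x = x ^ α * F x) {a b : ℝ} (ha : 0 < a) (x : ℝ) (hx : x ∈ Set.Icc a b) :
    a ^ α * F b ≤ l x ∧ l x ≤ b ^ α * F a := by
  have hx0 : 0 < x := lt_of_lt_of_le ha hx.1
  have hb0 : 0 < b := lt_of_lt_of_le hx0 hx.2
  have h1 := h.pos _ ha
  have h2 := h.pos _ hx0
  have h3 := h.pos _ hb0
  rw [hlF x hx0]
  constructor
  · exact mul_le_mul (Real.rpow_le_rpow ha.le hx.1 hα.le) (h.anti _ _ hx0 hx.2) h3.le (by positivity)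
  · exact mul_le_mul (Real.rpow_le_rpow hx0.le hx.2 hα.le) (h.anti _ _ ha hx.1) h2.le (by positivity)

lemma l_img {F l : ℝ → ℝ} {α : ℝ} (hα : 0 < α) (h : RV F α)
    (hlF : ∀ x, 0 < x → l x = x ^ α * F x) {a b : ℝ} (ha : 0 < a) (hab : a ≤ b) :
    BddAbove (l '' Set.Icc a b) ∧ BddBelow (l '' Set.Icc a b) ∧ 0 < sInf (l '' Set.Icc a b) := by
  have hb0 : 0 < b := lt_of_lt_of_le ha hab
  have h3 := h.pos _ hb0
  refine ⟨⟨b ^ α * F a, ?_⟩, ⟨a ^ α * F b, ?_⟩, ?_⟩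
  · rintro _ ⟨x, hx, rfl⟩; exact (l_bounds hα h hlF ha x hx).2
  · rintro _ ⟨x, hx, rfl⟩; exact (l_bounds hα h hlF ha x hx).1
  · have hne : (l '' Set.Icc a b).Nonempty := ⟨_, a, ⟨le_rfl, hab⟩, rfl⟩
    refine lt_of_lt_of_le (show 0 < a ^ α * F b by positivity) (le_csInf hne ?_)
    rintro _ ⟨x, hx, rfl⟩; exact (l_bounds hα h hlF ha x hx).1

lemma I_facts {F l : ℝ → ℝ} {α δ : ℝ} (hα : 0 < α) (h : RV F α)
    (hlF : ∀ x, 0 < x → l x = x ^ α * F x) (hδ : 0 < δ) (hδα : δ < α)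
    (b : ℕ → ℝ) (hb0 : ∀ n, 0 < b n)
    (hb : Tendsto b atTop atTop) (hr : Tendsto (fun n : ℕ => n * F (b n)) atTop (𝓝 1)) :
    (∀ᶠ n in atTop, b n ∈ Iset l α δ n) ∧
    (∀ T : ℝ, ∀ᶠ n in atTop, ∀ x ∈ Iset l α δ n, T ≤ x) ∧
    (∀ᶠ n in atTop, BddAbove (l '' Iset l α δ n) ∧ BddBelow (l '' Iset l α δ n) ∧
      0 < sInf (l '' Iset l α δ n)) := by
  have hαd : 0 < α - δ := by linarith
  have hnt : Tendsto (fun n : ℕ => (n:ℝ)) atTop atTop := tendsto_natCast_atTop_atTop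
  have hlogn : Tendsto (fun n : ℕ => Real.log n) atTop atTop := Real.tendsto_log_atTop.comp hnt
  have hlogb : Tendsto (fun n : ℕ => Real.log (b n)) atTop atTop := Real.tendsto_log_atTop.comp hb
  have hexp : 1 / (α + δ) ≤ (1 + δ) / (α - δ) := by
    rw [div_le_div_iff₀ (by positivity) hαd]; nlinarith
  have hJ : ∀ᶠ n : ℕ in atTop, 0 < (n:ℝ) ^ (1 / (α + δ)) ∧
      (n:ℝ) ^ (1 / (α + δ)) ≤ (n:ℝ) ^ ((1 + δ) / (α - δ)) := by
    filter_upwards [eventually_ge_atTop 1] with n hn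
    have hn' : (1:ℝ) ≤ n := by exact_mod_cast hn
    exact ⟨by positivity, Real.rpow_le_rpow_of_exponent_le hn' hexp⟩
  have hbJ : ∀ᶠ n in atTop, b n ∈ Jset α δ n := by
    filter_upwards [b_log h b hb0 hr, hb.eventually (log_rv hα h (δ/2) (by positivity)),
      hlogb.eventually_ge_atTop (2 / δ), eventually_ge_atTop 1, hlogn.eventually_ge_atTop 0]
      with n h1 h2 h3 h4 h5
    have hn' : (0:ℝ) < n := by exact_mod_cast h4
    have hbn := hb0 n
    rw [div_le_iff₀ hδ] at h3
    rw [abs_le] at h1 h2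
    constructor
    · rw [← Real.log_le_log_iff (by positivity) hbn, Real.log_rpow hn', div_mul_eq_mul_div,
        div_le_iff₀ (by positivity)]
      nlinarith
    · rw [← Real.log_le_log_iff hbn (by positivity), Real.log_rpow hn', div_mul_eq_mul_div,
        le_div_iff₀ (by positivity)]
      nlinarith
  have hinfJ : ∀ᶠ n : ℕ in atTop, (n:ℝ) ^ (-(1/2):ℝ) ≤ sInf (l '' Jset α δ n) := by
    set e := (1/2) / ((1 + δ) / (α - δ)) with he
    have he0 : 0 < e := by positivity
    obtain ⟨T, hT⟩ := eventually_atTop.1 (log_rv hα h e he0)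
    have hlow : Tendsto (fun n : ℕ => (n:ℝ) ^ (1 / (α + δ))) atTop atTop :=
      (tendsto_rpow_atTop (by positivity)).comp hnt
    filter_upwards [hJ, hlow.eventually_ge_atTop T, eventually_ge_atTop 1] with n h1 h2 h3
    have hn' : (0:ℝ) < n := by exact_mod_cast h3
    refine le_csInf ⟨_, _, ⟨le_rfl, h1.2⟩, rfl⟩ ?_
    rintro _ ⟨x, hx, rfl⟩
    have hx0 : 0 < x := lt_of_lt_of_le h1.1 hx.1
    have hFx := h.pos x hx0
    have h4 := hT x (h2.trans hx.1)
    rw [← hlF x hx0] at h4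
    have hlx : 0 < l x := by rw [hlF x hx0]; positivity
    have h5 := Real.log_le_log hx0 hx.2
    rw [Real.log_rpow hn'] at h5
    rw [← Real.log_le_log_iff (by positivity) hlx, Real.log_rpow hn']
    have h6 : e * Real.log x ≤ e * ((1 + δ) / (α - δ) * Real.log n) := by gcongr
    have h7 : e * ((1 + δ) / (α - δ) * Real.log n) = 1/2 * Real.log n := by
      rw [he]; field_simp
    rw [abs_le] at h4
    linarith [h4.1]
  have hlowI : ∀ T : ℝ, ∀ᶠ n : ℕ in atTop, T ≤ (n:ℝ) ^ (1 / α) * lTwo l α δ n := by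
    intro T
    have h1 : Tendsto (fun n : ℕ => ((1/2) * (n:ℝ) ^ (1/2:ℝ)) ^ (1 / α)) atTop atTop :=
      (tendsto_rpow_atTop (by positivity)).comp
        (((tendsto_rpow_atTop (by norm_num)).comp hnt).const_mul_atTop (by norm_num))
    filter_upwards [hinfJ, h1.eventually_ge_atTop T, eventually_ge_atTop 1] with n h2 h3 h4
    have hn' : (0:ℝ) < n := by exact_mod_cast h4
    refine h3.trans ?_
    have h5 : 0 < sInf (l '' Jset α δ n) := lt_of_lt_of_le (by positivity) h2
    unfold lTwo
    rw [← Real.mul_rpow (by positivity) (by positivity)]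
    refine Real.rpow_le_rpow (by positivity) ?_ (by positivity)
    calc (1/2) * (n:ℝ) ^ (1/2:ℝ) = n * (1/2 * (n:ℝ) ^ (-(1/2):ℝ)) := by
          have : (n:ℝ) ^ (1/2:ℝ) = n * (n:ℝ) ^ (-(1/2):ℝ) := by
            rw [← Real.rpow_one_add' hn'.le (by norm_num)]; norm_num
          rw [this]; ring
      _ ≤ _ := by gcongr
  have hbI : ∀ᶠ n in atTop, b n ∈ Iset l α δ n := by
    filter_upwards [hbJ, hJ, eventually_ge_atTop 1,
      hr.eventually (lt_mem_nhds (show (1/2:ℝ) < 1 by norm_num)),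
      hr.eventually (gt_mem_nhds (show (1:ℝ) < 2 by norm_num))] with n h1 h2 h3 h4 h5
    have hn' : (0:ℝ) < n := by exact_mod_cast h3
    have hbn := hb0 n
    have hFb := h.pos _ hbn
    obtain ⟨i1, i2, i3⟩ := l_img hα h hlF h2.1 h2.2
    have hmem : l (b n) ∈ l '' Jset α δ n := ⟨_, h1, rfl⟩
    have j1 : sInf (l '' Jset α δ n) ≤ l (b n) := csInf_le i2 hmem
    have j2 : l (b n) ≤ sSup (l '' Jset α δ n) := le_csSup i1 hmem
    have j3 : 0 < sInf (l '' Jset α δ n) := i3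
    have hlb : l (b n) = b n ^ α * F (b n) := hlF _ hbn
    have hbp : 0 < b n ^ α := by positivity
    have hbr : b n = (b n ^ α) ^ (1 / α) := by
      rw [← Real.rpow_mul hbn.le, mul_one_div_cancel hα.ne', Real.rpow_one]
    have hlp : 0 < l (b n) := by rw [hlb]; positivity
    constructor
    · unfold lTwo
      rw [← Real.mul_rpow hn'.le (by positivity), hbr]
      refine Real.rpow_le_rpow (by positivity) ?_ (by positivity)
      calc (n:ℝ) * (1/2 * sInf (l '' Jset α δ n)) ≤ n * (1/2 * l (b n)) := by gcongr
        _ = b n ^ α * (1/2 * (n * F (b n))) := by rw [hlb]; ring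
        _ ≤ b n ^ α * 1 := by gcongr; linarith
        _ = _ := mul_one _
    · unfold lOne
      have hm : 1 ≤ max (max (l n) (l n)⁻¹) 1 := le_max_right _ _
      have hmp : 0 < max (max (l n) (l n)⁻¹) 1 := by linarith
      have hsp : 0 < sSup (l '' Jset α δ n) := by linarith
      rw [← Real.mul_rpow hn'.le (by positivity)]
      conv_lhs => rw [hbr]
      refine Real.rpow_le_rpow (by positivity) ?_ (by positivity)
      calc b n ^ α = b n ^ α * 1 := (mul_one _).symm
        _ ≤ b n ^ α * (2 * (n * F (b n))) := by gcongr; linarith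
        _ = n * (2 * 1 * l (b n)) := by rw [hlb]; ring
        _ ≤ _ := by gcongr
  refine ⟨hbI, ?_, ?_⟩
  · intro T
    filter_upwards [hlowI T] with n hn x hx using hn.trans hx.1
  · filter_upwards [hlowI 1, hbI] with n h1 h2
    exact l_img hα h hlF (by linarith) (h2.1.trans h2.2)

lemma isOp_of {Ω : Type*} [MeasurableSpace Ω] (μ : Measure Ω) [IsProbabilityMeasure μ]
    (Y : ℕ → Ω → ℝ) (r : ℕ → ℝ) (B : ℕ → Set Ω) (C : ℝ) (hC : 0 < C)
    (hB : Tendsto (fun n => (μ (B n)).toReal) atTop (𝓝 0))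
    (hY : ∀ᶠ n in atTop, ∀ ω, ω ∉ B n → |Y n ω| ≤ C * r n) : IsOp μ Y r := by
  intro ε hε
  refine ⟨C, hC, ?_⟩
  filter_upwards [hB.eventually (gt_mem_nhds hε), hY] with n h1 h2
  refine lt_of_le_of_lt (measureReal_mono fun ω hω => ?_) h1
  by_contra hc
  have hω' : C * r n < |Y n ω| := hω
  linarith [h2 ω hc]

lemma core {Ω : Type*} [MeasurableSpace Ω] (μ : Measure Ω) [IsProbabilityMeasure μ]
    (X : ℕ → Ω → ℝ) (hXm : ∀ i, Measurable (X i)) (hX0 : ∀ i ω, 0 ≤ X i ω)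
    {F l : ℝ → ℝ} {α h₁ h₂ : ℝ} (hα : 0 < α) (h : RV F α) (hh₁ : α < h₁) (hh₂ : α < h₂)
    (hlF : ∀ x, 0 < x → l x = x ^ α * F x)
    (hXF : ∀ i, ∀ x, 0 < x → (μ {ω | x < X i ω}).toReal = F x)
    (hA : ∀ c v : ℕ → ℝ, (∀ n, 0 < c n) → Tendsto c atTop atTop →
      (Monotone fun n : ℕ => (n : ℝ) * c n) →
      Tendsto (fun n : ℕ => (n : ℝ) * c n) atTop atTop →
      Tendsto (fun n : ℕ => Real.log (c n) / Real.log n) atTop (nhds 0) →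
      (∀ n, 0 < v n) →
      Tendsto (fun n : ℕ => (n : ℝ) * l (v n) / (v n ^ α * c n)) atTop (nhds 1) →
      ConditionA μ X v c h₁ ∧ ConditionA μ X v c h₂)
    (b : ℕ → ℝ) (hb0 : ∀ n, 0 < b n) (hb : Tendsto b atTop atTop)
    (hrb : Tendsto (fun n : ℕ => n * F (b n)) atTop (𝓝 1))
    (hL : Tendsto (fun n => |Real.log (l (b n))|) atTop atTop) :
    ∃ C > 0, ∃ B : ℕ → Set Ω, Tendsto (fun n => (μ (B n)).toReal) atTop (𝓝 0) ∧
      ∀ᶠ n : ℕ in atTop, ∀ ω, ω ∉ B n →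
      |Real.log (sampleMoment X h₁ n ω) / Real.log (sampleMoment X h₂ n ω) -
            (h₁ - α) / (h₂ - α)| ≤ C * (|Real.log (l (b n))| / Real.log n) ∧
      |(Real.log (sampleMoment X h₁ n ω) / Real.log (sampleMoment X h₂ n ω) -
            (h₁ - α) / (h₂ - α))⁻¹| ≤ C * (Real.log n / |Real.log (l (b n))|) := by
  have hLe : ∀ n, Real.log (l (b n)) = Real.log (b n ^ α * F (b n)) := fun n => by
    rw [hlF _ (hb0 n)]
  simp only [hLe] at hL ⊢
  have hnt : Tendsto (fun n : ℕ => (n:ℝ)) atTop atTop := tendsto_natCast_atTop_atTop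
  have hlogn : Tendsto (fun n : ℕ => Real.log n) atTop atTop := Real.tendsto_log_atTop.comp hnt
  obtain ⟨c, hc0, hcm, hc, hcL⟩ := slow_seq _ hL
  have hlogc : Tendsto (fun n => Real.log (c n)) atTop atTop := Real.tendsto_log_atTop.comp hc
  have hsm := L_small hα h b hb0 hb hrb
  have hcle : ∀ η > 0, ∀ᶠ n : ℕ in atTop, Real.log (c n) ≤ η * Real.log n := by
    intro η hη
    filter_upwards [hsm η hη, hcL.eventually (gt_mem_nhds one_pos), hL.eventually_gt_atTop 0]
      with n h1 h2 h3
    rw [div_lt_one h3] at h2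
    linarith
  have hclog : Tendsto (fun n : ℕ => Real.log (c n) / Real.log n) atTop (𝓝 0) := by
    rw [Metric.tendsto_nhds]
    intro ε hε
    filter_upwards [hcle (ε/2) (by positivity), hlogn.eventually_gt_atTop 0,
      hlogc.eventually_ge_atTop 0] with n h1 h2 h3
    rw [Real.dist_eq, sub_zero, abs_of_nonneg (by positivity), div_lt_iff₀ h2]
    nlinarith
  have hcn0 : Tendsto (fun n : ℕ => c n / n) atTop (𝓝[>] 0) := by
    rw [tendsto_nhdsWithin_iff]
    constructor
    · have h1 : Tendsto (fun n : ℕ => Real.exp (-(1/2 * Real.log n))) atTop (𝓝 0) :=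
        Real.tendsto_exp_neg_atTop_nhds_zero.comp (hlogn.const_mul_atTop (by norm_num))
      refine tendsto_of_tendsto_of_tendsto_of_le_of_le' tendsto_const_nhds h1
        (Eventually.of_forall fun n => div_nonneg (hc0 n).le (Nat.cast_nonneg n)) ?_
      filter_upwards [hcle (1/2) (by norm_num), eventually_gt_atTop 0] with n h2 h3
      have hn' : (0:ℝ) < n := by exact_mod_cast h3
      have := hc0 n
      rw [← Real.log_le_iff_le_exp (by positivity), Real.log_div this.ne' hn'.ne']
      linarith
    · filter_upwards [eventually_gt_atTop 0] with n h3
      have hn' : (0:ℝ) < n := by exact_mod_cast h3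
      exact div_pos (hc0 n) hn'
  obtain ⟨Q, hQ0, hQt, hQr⟩ := quantile hα h
  set v : ℕ → ℝ := fun n => Q (c n / n) with hv
  have hv0 : ∀ n, 0 < v n := fun n => hQ0 _
  have hvt : Tendsto v atTop atTop := hQt.comp hcn0
  have hvr : Tendsto (fun n : ℕ => n * F (v n) / c n) atTop (𝓝 1) := by
    refine (hQr.comp hcn0).congr fun n => ?_
    simp only [Function.comp, hv]
    rw [div_div_eq_mul_div, mul_comm]
  have hvr' : Tendsto (fun n : ℕ => (n : ℝ) * l (v n) / (v n ^ α * c n)) atTop (𝓝 1) := by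
    refine hvr.congr fun n => ?_
    have := hv0 n
    have := hc0 n
    rw [hlF _ (hv0 n)]
    field_simp
  obtain ⟨A1, A2⟩ := hA c v hc0 hc
    (fun m n hmn => mul_le_mul (by exact_mod_cast hmn) (hcm hmn) (hc0 m).le (Nat.cast_nonneg n))
    (hnt.atTop_mul_atTop₀ hc) hclog hv0 hvr'
  obtain ⟨η, hη, C, hC, hdet⟩ := det_ratio α h₁ h₂ hα hh₁ hh₂
  have m1 := moment_log μ X hXm hX0 hα h hh₁ hXF c v b hc0 hc hv0 hvt hvr hb0 hb hrb hL hcL A1 η hη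
  have m2 := moment_log μ X hXm hX0 hα h hh₂ hXF c v b hc0 hc hv0 hvt hvr hb0 hb hrb hL hcL A2 η hη
  have m3 := m1.add m2
  rw [add_zero] at m3
  refine ⟨C, hC, fun n => _ ∪ _, tendsto_of_tendsto_of_tendsto_of_le_of_le tendsto_const_nhds m3
    (fun n => ENNReal.toReal_nonneg) (fun n => measureReal_union_le (μ := μ) _ _), ?_⟩
  filter_upwards [hsm η hη, hlogn.eventually_gt_atTop 0, hL.eventually_gt_atTop 0]
    with n h1 h2 h3 ω hω
  simp only [Set.mem_union, Set.mem_ofPred_eq, not_or, not_not] at hω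
  exact hdet _ _ _ _ h2 (abs_pos.1 h3) h1 hω.1 hω.2 (fun e => by rw [e])

lemma rv_of {Ω : Type*} [MeasurableSpace Ω] (μ : Measure Ω) [IsProbabilityMeasure μ]
    (Y : Ω → ℝ) {α : ℝ} {l : ℝ → ℝ} (hlpos : ∀ x : ℝ, 0 < x → 0 < l x) (hl : SlowlyVarying l)
    (hsurv : ∀ x : ℝ, 0 < x → (μ {ω | x < Y ω}).toReal = x ^ (-α) * l x) :
    RV (fun x => x ^ (-α) * l x) α := by
  refine ⟨fun x hx => mul_pos (by positivity) (hlpos x hx), ?_, ?_⟩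
  · intro x y hx hxy
    show y ^ (-α) * l y ≤ x ^ (-α) * l x
    rw [← hsurv x hx, ← hsurv y (hx.trans_le hxy)]
    refine measureReal_mono fun ω hω => ?_
    have hω' : y < Y ω := hω
    show x < Y ω
    linarith
  · intro r hr
    have := (hl r hr).const_mul (r ^ (-α))
    rw [mul_one] at this
    refine this.congr' ?_
    filter_upwards [eventually_gt_atTop 0] with x hx
    have := hlpos x hx
    rw [Real.mul_rpow hr.le hx.le]
    have : 0 < x ^ (-α) := by positivity
    field_simp

/-- **Theorem (Taylor's law for higher moments, rate-of-convergence part).**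
Assume Condition A(h₁) and A(h₂) hold for every admissible choice of `(c_n)` and `(v_n)`.
Let `R_n = log M_{n,h₁}/log M_{n,h₂} − (h₁−α)/(h₂−α)`.
(i) If `l(x) → ∞`, then `R_n = O_p(s_{1n,l})` and `R_n⁻¹ = O_p(s_{2n,l}⁻¹)`.
(ii) If `l(x) → 0`, then `R_n = O_p(s_{2n,l})` and `R_n⁻¹ = O_p(s_{1n,l}⁻¹)`. -/
theorem taylors_law_higher_moments_rates
    {Ω : Type*} [MeasurableSpace Ω] (μ : Measure Ω) [IsProbabilityMeasure μ]
    (X : ℕ → Ω → ℝ) (hXmeas : ∀ i, Measurable (X i)) (hXnn : ∀ i ω, 0 ≤ X i ω)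
    (α : ℝ) (hα : 0 < α)
    (l : ℝ → ℝ) (hlpos : ∀ x : ℝ, 0 < x → 0 < l x) (hl : SlowlyVarying l)
    (hsurv : ∀ i, ∀ x : ℝ, 0 < x → (μ {ω | x < X i ω}).toReal = x ^ (-α) * l x)
    (δ : ℝ) (hδ : 0 < δ) (hδα : δ < α)
    (h₁ h₂ : ℝ) (hh₁ : α < h₁) (hh₂ : α < h₂)
    (hA : ∀ c v : ℕ → ℝ, (∀ n, 0 < c n) → Tendsto c atTop atTop →
      (Monotone fun n : ℕ => (n : ℝ) * c n) →
      Tendsto (fun n : ℕ => (n : ℝ) * c n) atTop atTop →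
      Tendsto (fun n : ℕ => Real.log (c n) / Real.log n) atTop (nhds 0) →
      (∀ n, 0 < v n) →
      Tendsto (fun n : ℕ => (n : ℝ) * l (v n) / (v n ^ α * c n)) atTop (nhds 1) →
      ConditionA μ X v c h₁ ∧ ConditionA μ X v c h₂) :
    (Tendsto l atTop atTop →
      IsOp μ (fun n ω =>
          Real.log (sampleMoment X h₁ n ω) / Real.log (sampleMoment X h₂ n ω) -
            (h₁ - α) / (h₂ - α)) (sOne l α δ) ∧
      IsOp μ (fun n ω =>
          (Real.log (sampleMoment X h₁ n ω) / Real.log (sampleMoment X h₂ n ω) -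
            (h₁ - α) / (h₂ - α))⁻¹) (fun n => (sTwo l α δ n)⁻¹)) ∧
    (Tendsto l atTop (nhds 0) →
      IsOp μ (fun n ω =>
          Real.log (sampleMoment X h₁ n ω) / Real.log (sampleMoment X h₂ n ω) -
            (h₁ - α) / (h₂ - α)) (sTwo l α δ) ∧
      IsOp μ (fun n ω =>
          (Real.log (sampleMoment X h₁ n ω) / Real.log (sampleMoment X h₂ n ω) -
            (h₁ - α) / (h₂ - α))⁻¹) (fun n => (sOne l α δ n)⁻¹)) := by
  set F : ℝ → ℝ := fun x => x ^ (-α) * l x with hF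
  have h : RV F α := rv_of μ (X 0) hlpos hl (hsurv 0)
  have hlF : ∀ x, 0 < x → l x = x ^ α * F x := by
    intro x hx
    simp only [hF]
    rw [← mul_assoc, ← Real.rpow_add hx]
    simp
  obtain ⟨Q, hQ0, hQt, hQr⟩ := quantile hα h
  have hn0 : Tendsto (fun n : ℕ => (n:ℝ)⁻¹) atTop (𝓝[>] 0) :=
    tendsto_inv_atTop_nhdsGT_zero.comp tendsto_natCast_atTop_atTop
  set b : ℕ → ℝ := fun n => Q (n:ℝ)⁻¹ with hb
  have hb0 : ∀ n, 0 < b n := fun n => hQ0 _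
  have hbt : Tendsto b atTop atTop := hQt.comp hn0
  have hrb : Tendsto (fun n : ℕ => n * F (b n)) atTop (𝓝 1) := by
    refine (hQr.comp hn0).congr fun n => ?_
    simp only [Function.comp, hb]
    rw [div_inv_eq_mul, mul_comm]
  obtain ⟨hbI, hIlow, hIimg⟩ := I_facts hα h hlF hδ hδα b hb0 hbt hrb
  have hlogn : Tendsto (fun n : ℕ => Real.log n) atTop atTop :=
    Real.tendsto_log_atTop.comp tendsto_natCast_atTop_atTop
  have hfin : ∀ s t : ℕ → ℝ, Tendsto (fun n => |Real.log (l (b n))|) atTop atTop →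
      (∀ᶠ n in atTop, |Real.log (l (b n))| ≤ |Real.log (s n)|) →
      (∀ᶠ n in atTop, 0 < |Real.log (t n)| ∧ |Real.log (t n)| ≤ |Real.log (l (b n))|) →
      IsOp μ (fun n ω =>
          Real.log (sampleMoment X h₁ n ω) / Real.log (sampleMoment X h₂ n ω) -
            (h₁ - α) / (h₂ - α)) (fun n => |Real.log (s n)| / Real.log n) ∧
      IsOp μ (fun n ω =>
          (Real.log (sampleMoment X h₁ n ω) / Real.log (sampleMoment X h₂ n ω) -
            (h₁ - α) / (h₂ - α))⁻¹) (fun n => (|Real.log (t n)| / Real.log n)⁻¹) := by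
    intro s t hL hs ht
    obtain ⟨C, hC, B, hB, hR⟩ := core μ X hXmeas hXnn hα h hh₁ hh₂ hlF hsurv hA b hb0 hbt hrb hL
    constructor
    · refine isOp_of μ _ _ B C hC hB ?_
      filter_upwards [hR, hs, hlogn.eventually_gt_atTop 0] with n k1 k2 k3 ω hω
      refine (k1 ω hω).1.trans ?_
      gcongr
    · refine isOp_of μ _ _ B C hC hB ?_
      filter_upwards [hR, ht, hlogn.eventually_gt_atTop 0] with n k1 k2 k3 ω hω
      refine (k1 ω hω).2.trans ?_
      obtain ⟨k4, k5⟩ := k2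
      rw [inv_div]
      gcongr
  constructor
  · intro hli
    have hlb : Tendsto (fun n => Real.log (l (b n))) atTop atTop :=
      Real.tendsto_log_atTop.comp (hli.comp hbt)
    obtain ⟨T, hT⟩ := eventually_atTop.1 (hli.eventually_ge_atTop 2)
    refine hfin (fun n => sSup (l '' Iset l α δ n)) (fun n => sInf (l '' Iset l α δ n))
      (tendsto_abs_atTop_atTop.comp hlb) ?_ ?_
    · filter_upwards [hbI, hIimg, hlb.eventually_ge_atTop 0] with n k1 k2 k3
      have hm : l (b n) ∈ l '' Iset l α δ n := ⟨_, k1, rfl⟩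
      have := Real.log_le_log (hlpos _ (hb0 n)) (le_csSup k2.1 hm)
      rw [abs_of_nonneg k3]
      exact this.trans (le_abs_self _)
    · filter_upwards [hbI, hIimg, hIlow T] with n k1 k2 k3
      have hm : l (b n) ∈ l '' Iset l α δ n := ⟨_, k1, rfl⟩
      have h2 : 2 ≤ sInf (l '' Iset l α δ n) := by
        refine le_csInf ⟨_, hm⟩ ?_
        rintro _ ⟨x, hx, rfl⟩
        exact hT x (k3 x hx)
      have h3 : 0 < Real.log (sInf (l '' Iset l α δ n)) := Real.log_pos (by linarith)
      have := Real.log_le_log (by linarith) (csInf_le k2.2.1 hm)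
      rw [abs_of_pos h3]
      exact ⟨h3, this.trans (le_abs_self _)⟩
  · intro hl0
    have hlb0 : Tendsto (fun n => l (b n)) atTop (𝓝[>] 0) := by
      rw [tendsto_nhdsWithin_iff]
      exact ⟨hl0.comp hbt, Eventually.of_forall fun n => hlpos _ (hb0 n)⟩
    have hlb : Tendsto (fun n => Real.log (l (b n))) atTop atBot :=
      Real.tendsto_log_nhdsGT_zero.comp hlb0
    obtain ⟨T, hT⟩ := eventually_atTop.1
      (hl0.eventually (gt_mem_nhds (show (0:ℝ) < 1/2 by norm_num)))
    refine hfin (fun n => sInf (l '' Iset l α δ n)) (fun n => sSup (l '' Iset l α δ n))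
      (tendsto_abs_atBot_atTop.comp hlb) ?_ ?_
    · filter_upwards [hbI, hIimg, hlb.eventually_le_atBot 0] with n k1 k2 k3
      have hm : l (b n) ∈ l '' Iset l α δ n := ⟨_, k1, rfl⟩
      have := Real.log_le_log k2.2.2 (csInf_le k2.2.1 hm)
      rw [abs_of_nonpos k3]
      exact (neg_le_neg this).trans (neg_le_abs _)
    · filter_upwards [hbI, hIimg, hIlow T] with n k1 k2 k3
      have hm : l (b n) ∈ l '' Iset l α δ n := ⟨_, k1, rfl⟩
      have h2 : sSup (l '' Iset l α δ n) ≤ 1/2 := by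
        refine csSup_le ⟨_, hm⟩ ?_
        rintro _ ⟨x, hx, rfl⟩
        exact (hT x (k3 x hx)).le
      have hlp := hlpos _ (hb0 n)
      have h4 := le_csSup k2.1 hm
      have h3 : Real.log (sSup (l '' Iset l α δ n)) < 0 :=
        Real.log_neg (by linarith) (by linarith)
      have := Real.log_le_log hlp h4
      rw [abs_of_neg h3]
      exact ⟨by linarith, (neg_le_neg this).trans (neg_le_abs _)⟩
end
end

section
/- For each positive integer n > 1, let u_n be an integer with 0 < u_n < n and u_n/n → p* ∈ (0,1]. On a probability space, let X_{1,U},…,X_{u_n,U} be nonnegative random variables with common survival function P(X_{i,U} > x) = x^{-α} l(x) for all x > 0, where α ∈ (0,1) and l is slowly varying at infinity, and let X_{1,V},…,X_{n−u_n,V} be nonnegative identically distributed random variables with P(X_{1,V} > x)/P(X_{1,U} > x) → 0 as x → ∞. Define M_{n,p} := n^{-1}·(∑_{i=1}^{u_n} X_{i,U}^p + ∑_{i=1}^{n−u_n} X_{i,V}^p). Let h₁, h₂ > α, and assume that ∑_{1≤i,j≤n, i≠j} Cov(Y̌ᵢ^p, Y̌ⱼ^p) / (v_n^{2p}·c_n²)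 → 0 for p = h₁ and p = h₂. Then log M_{n,h₁}/log M_{n,h₂} − (h₁−α)/(h₂−α) = O_p((log c_n + |log l(t_n)|)/log n) as n → ∞. -/
open MeasureTheory Filter

noncomputable section

/-- The combined heterogeneous sample: the first `u n` variables are the `U`-variables,
the remaining `n − u n` are the `V`-variables. -/
def hetY {Ω : Type*} (XU XV : ℕ → Ω → ℝ) (u : ℕ → ℕ) (n i : ℕ) : Ω → ℝ :=
  if i < u n then XU i else XV (i - u n)

/-- `p`-th sample moment of the heterogeneous sample. -/
def hetMoment {Ω : Type*} (XU XV : ℕ → Ω → ℝ) (u : ℕ → ℕ) (p : ℝ) (n : ℕ) (ω : Ω) : ℝ :=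
  (n : ℝ)⁻¹ * ∑ i ∈ Finset.range n, hetY XU XV u n i ω ^ p

section helpers
open Real

lemma aux_iter_le (F : ℝ → ℝ) (r x0 : ℝ) (hr : 0 ≤ r)
    (h : ∀ x, x0 ≤ x → F (2 * x) ≤ r * F x) (k : ℕ) (x : ℝ) (hx0 : 0 < x0) (hx : x0 ≤ x) :
    F (2 ^ k * x) ≤ r ^ k * F x := by
  induction k with
  | zero => simp
  | succ k ih =>
    have h2 : x0 ≤ 2 ^ k * x := by
      have : (1 : ℝ) ≤ 2 ^ k := one_le_pow₀ (by norm_num)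
      nlinarith
    have := h _ h2
    calc F (2 ^ (k + 1) * x) = F (2 * (2 ^ k * x)) := by ring_nf
      _ ≤ r * F (2 ^ k * x) := this
      _ ≤ r * (r ^ k * F x) := by gcongr
      _ = _ := by ring

lemma aux_iter_ge (F : ℝ → ℝ) (r x0 : ℝ) (hr : 0 ≤ r)
    (h : ∀ x, x0 ≤ x → r * F x ≤ F (2 * x)) (k : ℕ) (x : ℝ) (hx0 : 0 < x0) (hx : x0 ≤ x) :
    r ^ k * F x ≤ F (2 ^ k * x) := by
  have := aux_iter_le (fun x => - F x) r x0 hr (fun x hx => by have := h x hx; simp; linarith) k x hx0 hx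
  simp at this; linarith

lemma aux_lower (F : ℝ → ℝ) (α q : ℝ) (hF : ∀ x, 0 < x → 0 < F x)
    (hanti : ∀ x y, 0 < x → x ≤ y → F y ≤ F x)
    (h2 : Tendsto (fun x => F (2 * x) / F x) atTop (nhds ((2 : ℝ) ^ (-α))))
    (hq0 : 0 < q) (hq : q < α) :
    ∃ C x0 : ℝ, 0 < C ∧ 0 < x0 ∧ ∀ x y, x0 ≤ x → x ≤ y → F y ≤ C * (x / y) ^ q * F x := by
  have hlt : (2 : ℝ) ^ (-α) < 2 ^ (-q) := Real.rpow_lt_rpow_of_exponent_lt (by norm_num) (by linarith)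
  obtain ⟨x1, hx1⟩ := eventually_atTop.1 (h2.eventually (gt_mem_nhds hlt))
  refine ⟨2 ^ q, max x1 1, by positivity, by positivity, fun x y hx hxy => ?_⟩
  have hx0 : 0 < x := lt_of_lt_of_le (by positivity) hx
  have hy0 : 0 < y := by linarith
  obtain ⟨k, hk1, hk2⟩ := exists_nat_pow_near (x := y / x) (y := (2 : ℝ)) ((one_le_div hx0).2 hxy) (by norm_num)
  rw [le_div_iff₀ hx0] at hk1
  rw [div_lt_iff₀ hx0] at hk2
  have h := aux_iter_le F (2 ^ (-q)) (max x1 1) (by positivity) (fun z hz => by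
    have hz0 : 0 < z := lt_of_lt_of_le (by positivity) hz
    have := hx1 z (le_trans (le_max_left _ _) hz)
    rw [div_lt_iff₀ (hF z hz0)] at this
    exact this.le) k x (by positivity) hx
  calc F y ≤ F (2 ^ k * x) := hanti _ _ (by positivity) hk1
    _ ≤ (2 ^ (-q)) ^ k * F x := h
    _ ≤ 2 ^ q * (x / y) ^ q * F x := by
      have := hF x hx0
      gcongr
      rw [← Real.mul_rpow (by norm_num) (by positivity), ← Real.rpow_natCast, ← Real.rpow_mul (by norm_num),
        mul_comm, Real.rpow_mul (by norm_num), Real.rpow_neg (by positivity),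
        ← Real.inv_rpow (by positivity)]
      gcongr
      rw [Real.rpow_natCast, ← mul_div_assoc, le_div_iff₀ hy0, inv_mul_le_iff₀ (by positivity)]
      rw [pow_succ] at hk2; linarith

lemma aux_upper (F : ℝ → ℝ) (α q : ℝ) (hF : ∀ x, 0 < x → 0 < F x) (hF1 : ∀ x, 0 < x → F x ≤ 1)
    (hanti : ∀ x y, 0 < x → x ≤ y → F y ≤ F x)
    (h2 : Tendsto (fun x => F (2 * x) / F x) atTop (nhds ((2 : ℝ) ^ (-α))))
    (hq0 : 0 < q) (hq : α < q) :
    ∃ C x0 : ℝ, 0 < C ∧ 0 < x0 ∧ ∀ t x, x0 ≤ t → 0 < x → x ≤ t → F x ≤ C * (t / x) ^ q * F t := by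
  have hlt : (2 : ℝ) ^ (-q) < 2 ^ (-α) := Real.rpow_lt_rpow_of_exponent_lt (by norm_num) (by linarith)
  obtain ⟨x1, hx1⟩ := eventually_atTop.1 (h2.eventually (lt_mem_nhds hlt))
  set x0 := max x1 1 with hx0def
  have hx00 : 0 < x0 := by positivity
  have key : ∀ t x, x0 ≤ x → x ≤ t → F x ≤ 2 ^ q * (t / x) ^ q * F t := by
    intro y x hx hxy
    have hx0 : 0 < x := lt_of_lt_of_le (by positivity) hx
    have hy0 : 0 < y := by linarith
    obtain ⟨k, hk1, hk2⟩ := exists_nat_pow_near (x := y / x) (y := (2 : ℝ)) ((one_le_div hx0).2 hxy) (by norm_num)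
    have h := aux_iter_ge F (2 ^ (-q)) x0 (by positivity) (fun z hz => by
      have hz0 : 0 < z := lt_of_lt_of_le (by positivity) hz
      have := hx1 z (le_trans (le_max_left _ _) hz)
      rw [lt_div_iff₀ (hF z hz0)] at this
      exact this.le) (k + 1) x (by positivity) hx
    rw [div_lt_iff₀ hx0] at hk2
    have h3 : F (2 ^ (k + 1) * x) ≤ F y := hanti _ _ hy0 hk2.le
    have h4 : ((2 : ℝ) ^ (-q)) ^ (k + 1) = ((2 ^ (k + 1) : ℝ) ^ q)⁻¹ := by
      rw [← Real.rpow_natCast, ← Real.rpow_natCast, ← Real.rpow_mul (by norm_num), ← Real.rpow_mul (by norm_num),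
        ← Real.rpow_neg (by norm_num)]
      congr 1; ring
    rw [h4] at h
    have h5 := h.trans h3
    rw [inv_mul_le_iff₀ (by positivity)] at h5
    refine h5.trans ?_
    have := hF y hy0
    gcongr
    rw [← Real.mul_rpow (by norm_num) (by positivity)]
    gcongr
    rw [pow_succ, mul_comm]
    gcongr
  refine ⟨2 ^ q * (1 + 1 / F x0), x0, ?_, hx00, fun t x ht hx hxt => ?_⟩
  · have := hF x0 hx00; positivity
  have hFx0 := hF x0 hx00
  have hFt := hF t (by linarith)
  have ht0 : 0 < t := by linarith
  by_cases hxx : x0 ≤ x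
  · refine (key t x hxx hxt).trans ?_
    gcongr
    have : (0 : ℝ) < 1 / F x0 := by positivity
    have h2q : (0 : ℝ) < 2 ^ q := by positivity
    nlinarith
  · push Not at hxx
    have h1 := key t x0 le_rfl ht
    calc F x ≤ 1 := hF1 x hx
      _ = 1 / F x0 * F x0 := by field_simp
      _ ≤ 1 / F x0 * (2 ^ q * (t / x0) ^ q * F t) := by gcongr
      _ ≤ (1 + 1 / F x0) * (2 ^ q * (t / x) ^ q * F t) := by
        have : (0 : ℝ) ≤ 1 := by norm_num
        gcongr
        linarith
      _ = _ := by ring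

end helpers
section helpers2
open Real

lemma aux_trunc_nn {Ω : Type*} (X : Ω → ℝ) (hnn : ∀ ω, 0 ≤ X ω) (t : ℝ) (ω : Ω) : 0 ≤ trunc X t ω := by
  unfold trunc; split_ifs; exacts [hnn ω, le_rfl]

lemma aux_trunc_le {Ω : Type*} (X : Ω → ℝ) (t : ℝ) (ht : 0 < t) (ω : Ω) : trunc X t ω ≤ t := by
  unfold trunc; split_ifs with h; exacts [h.le, ht.le]

lemma aux_trunc_le' {Ω : Type*} (X : Ω → ℝ) (hnn : ∀ ω, 0 ≤ X ω) (t : ℝ) (ω : Ω) : trunc X t ω ≤ X ω := by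
  unfold trunc; split_ifs with h; exacts [le_rfl, hnn ω]

variable {Ω : Type*} [MeasurableSpace Ω] (μ : Measure Ω) [IsProbabilityMeasure μ]

lemma aux_trunc_meas (X : Ω → ℝ) (hm : Measurable X) (t : ℝ) : Measurable (trunc X t) := by
  unfold trunc
  exact Measurable.ite (measurableSet_lt hm measurable_const) hm measurable_const

lemma aux_trunc_int (X : Ω → ℝ) (hm : Measurable X) (hnn : ∀ ω, 0 ≤ X ω) (t p : ℝ) (ht : 0 < t)
    (hp : 0 < p) : Integrable (fun ω => trunc X t ω ^ p) μ := by
  refine Integrable.of_bound ((aux_trunc_meas X hm t).pow_const p).aestronglyMeasurable (t ^ p) ?_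
  refine ae_of_all _ fun ω => ?_
  have := aux_trunc_nn X hnn t ω
  have := aux_trunc_le X t ht ω
  rw [Real.norm_of_nonneg (by positivity)]
  gcongr

lemma aux_moment_le (X : Ω → ℝ) (hm : Measurable X) (hnn : ∀ ω, 0 ≤ X ω)
    (t p q A : ℝ) (ht : 0 < t) (hq : 0 < q) (hpq : q < p) (hA : 0 ≤ A)
    (hT : ∀ x, 0 < x → x ≤ t → μ.real {ω | x < X ω} ≤ A * (t / x) ^ q) :
    ∫ ω, trunc X t ω ^ p ∂μ ≤ A * (p / (p - q)) * t ^ p := by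
  have hp : 0 < p := by linarith
  have hpq' : 0 < p - q := by linarith
  have hnn' := aux_trunc_nn X hnn t
  rw [integral_eq_lintegral_of_nonneg_ae (ae_of_all _ fun ω => by have := hnn' ω; simp only [Pi.zero_apply]; positivity)
    ((aux_trunc_meas X hm t).pow_const p).aestronglyMeasurable]
  refine ENNReal.toReal_le_of_le_ofReal (by positivity) ?_
  rw [lintegral_rpow_eq_lintegral_meas_lt_mul μ (ae_of_all _ hnn') (aux_trunc_meas X hm t).aemeasurable hp]
  have hi : IntegrableOn (fun x : ℝ => A * t ^ q * x ^ (p - q - 1)) (Set.Ioc 0 t) volume := by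
    apply Integrable.const_mul
    have := (intervalIntegral.intervalIntegrable_rpow' (a := 0) (b := t) (r := p - q - 1) (by linarith))
    rwa [intervalIntegrable_iff_integrableOn_Ioc_of_le ht.le] at this
  have h1 : ∫⁻ x in Set.Ioi 0, μ {a | x < trunc X t a} * ENNReal.ofReal (x ^ (p - 1)) ≤
      ∫⁻ x in Set.Ioc 0 t, ENNReal.ofReal (A * t ^ q * x ^ (p - q - 1)) := by
    rw [← lintegral_indicator measurableSet_Ioi, ← lintegral_indicator measurableSet_Ioc]
    refine lintegral_mono fun x => ?_
    by_cases hx : 0 < x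
    · rw [Set.indicator_of_mem (by exact hx)]
      by_cases hxt : x ≤ t
      · rw [Set.indicator_of_mem (by exact ⟨hx, hxt⟩)]
        have h2 : μ {a | x < trunc X t a} ≤ ENNReal.ofReal (A * (t / x) ^ q) := by
          refine le_trans (measure_mono (t := {ω | x < X ω}) fun ω hω => lt_of_lt_of_le hω (aux_trunc_le' X hnn t ω)) ?_
          rw [← ofReal_measureReal]
          exact ENNReal.ofReal_le_ofReal (hT x hx hxt)
        calc _ ≤ ENNReal.ofReal (A * (t / x) ^ q) * ENNReal.ofReal (x ^ (p - 1)) := by gcongr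
          _ = _ := by
            rw [← ENNReal.ofReal_mul (by positivity)]
            congr 1
            rw [Real.div_rpow ht.le hx.le, show p - q - 1 = (p - 1) - q by ring, Real.rpow_sub hx (p - 1) q]
            ring
      · have : {a | x < trunc X t a} = ∅ := by
          ext ω; simp
          have := aux_trunc_le X t ht ω
          linarith
        simp [this]
    · rw [Set.indicator_of_notMem (by simpa using hx)]; simp
  calc _ ≤ ENNReal.ofReal p * ∫⁻ x in Set.Ioc 0 t, ENNReal.ofReal (A * t ^ q * x ^ (p - q - 1)) := by gcongr
    _ = ENNReal.ofReal p * ENNReal.ofReal (∫ x in Set.Ioc 0 t, A * t ^ q * x ^ (p - q - 1)) := by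
      rw [ofReal_integral_eq_lintegral_ofReal hi]
      filter_upwards [ae_restrict_mem measurableSet_Ioc] with x hx
      have := hx.1
      simp only [Pi.zero_apply]
      positivity
    _ = _ := by
      rw [← ENNReal.ofReal_mul hp.le]
      congr 1
      rw [← intervalIntegral.integral_of_le ht.le, intervalIntegral.integral_const_mul,
        integral_rpow (Or.inl (by linarith)), show p - q - 1 + 1 = p - q by ring,
        Real.zero_rpow hpq'.ne', sub_zero, Real.rpow_sub ht]
      have : 0 < t ^ q := by positivity
      field_simp

lemma aux_moment_ge (X : Ω → ℝ) (hm : Measurable X) (hnn : ∀ ω, 0 ≤ X ω)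
    (v p κ : ℝ) (hv : 0 < v) (hp : 0 < p)
    (hT : κ ≤ μ.real {ω | v / 4 < X ω} - μ.real {ω | v / 2 < X ω}) :
    (v / 4) ^ p * κ ≤ ∫ ω, trunc X v ω ^ p ∂μ := by
  have hint := aux_trunc_int μ X hm hnn v p hv hp
  have h := mul_meas_ge_le_integral_of_nonneg (μ := μ) (f := fun ω => trunc X v ω ^ p)
    (ae_of_all _ fun ω => by have := aux_trunc_nn X hnn v ω; simp only [Pi.zero_apply]; positivity) hint ((v / 4) ^ p)
  refine le_trans ?_ h
  gcongr
  refine hT.trans ?_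
  have : μ.real {ω | v / 4 < X ω} ≤ μ.real ({x | (v / 4) ^ p ≤ trunc X v x ^ p} ∪ {ω | v / 2 < X ω}) := by
    refine measureReal_mono fun ω hω => ?_
    simp only [Set.mem_ofPred_eq, Set.mem_union] at hω ⊢
    by_cases h : v / 2 < X ω
    · exact Or.inr h
    · left
      have : trunc X v ω = X ω := by unfold trunc; rw [if_pos]; linarith
      rw [this]
      gcongr
  have := this.trans (measureReal_union_le _ _)
  linarith

lemma aux_cheb (n : ℕ) (Z : ℕ → Ω → ℝ) (B m : ℝ) (hZm : ∀ i, Measurable (Z i))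
    (hZ0 : ∀ i ω, 0 ≤ Z i ω) (hZB : ∀ i ω, Z i ω ≤ B) (hm : 0 < m)
    (hle : m ≤ ∑ i ∈ Finset.range n, ∫ ω, Z i ω ∂μ) :
    μ.real {ω | ∑ i ∈ Finset.range n, Z i ω < m / 2} ≤
      4 * (B * ∑ i ∈ Finset.range n, ∫ ω, Z i ω ∂μ +
        ∑ i ∈ Finset.range n, ∑ j ∈ Finset.range n, if i = j then 0 else cov μ (Z i) (Z j)) / m ^ 2 := by
  have hL : ∀ i, MemLp (Z i) 2 μ := fun i => MemLp.of_bound (hZm i).aestronglyMeasurable B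
    (ae_of_all _ fun ω => by rw [Real.norm_of_nonneg (hZ0 i ω)]; exact hZB i ω)
  have hI : ∀ i, Integrable (Z i) μ := fun i => (hL i).integrable one_le_two
  have hSL : MemLp (∑ i ∈ Finset.range n, Z i) 2 μ := memLp_finsetSum' _ fun i _ => hL i
  have hES : (∫ ω, (∑ i ∈ Finset.range n, Z i) ω ∂μ) = ∑ i ∈ Finset.range n, ∫ ω, Z i ω ∂μ := by
    simp only [Finset.sum_apply]
    exact integral_finsetSum _ fun i _ => hI i
  have hch := ProbabilityTheory.meas_ge_le_variance_div_sq hSL (half_pos hm)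
  have hvar := ProbabilityTheory.variance_sum' (μ := μ) (s := Finset.range n) (X := Z) fun i _ => hL i
  have hvle : ProbabilityTheory.variance (∑ i ∈ Finset.range n, Z i) μ ≤
      B * ∑ i ∈ Finset.range n, ∫ ω, Z i ω ∂μ +
        ∑ i ∈ Finset.range n, ∑ j ∈ Finset.range n, if i = j then 0 else cov μ (Z i) (Z j) := by
    rw [hvar, Finset.mul_sum, ← Finset.sum_add_distrib]
    refine Finset.sum_le_sum fun i hi => ?_
    have hd : B * ∫ ω, Z i ω ∂μ = ∑ j ∈ Finset.range n, if i = j then B * ∫ ω, Z i ω ∂μ else 0 := by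
      rw [Finset.sum_ite_eq, if_pos hi]
    rw [hd, ← Finset.sum_add_distrib]
    refine Finset.sum_le_sum fun j hj => ?_
    rw [ProbabilityTheory.covariance_eq_sub (hL i) (hL j)]
    split_ifs with hij
    · subst hij
      have h1 : (∫ ω, (Z i * Z i) ω ∂μ) ≤ B * ∫ ω, Z i ω ∂μ := by
        rw [← integral_const_mul]
        refine integral_mono ?_ ((hI i).const_mul B) fun ω => ?_
        · exact (hL i).integrable_mul (hL i)
        · exact mul_le_mul_of_nonneg_right (hZB i ω) (hZ0 i ω)
      have := mul_self_nonneg (∫ ω, Z i ω ∂μ)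
      linarith
    · simp [cov]
  have hnn := ProbabilityTheory.variance_nonneg (∑ i ∈ Finset.range n, Z i) μ
  calc _ ≤ μ.real {ω | m / 2 ≤ |(∑ i ∈ Finset.range n, Z i) ω - (∫ ω, (∑ i ∈ Finset.range n, Z i) ω ∂μ)|} := by
        refine measureReal_mono fun ω hω => ?_
        simp only [Set.mem_ofPred_eq] at hω ⊢
        rw [hES, Finset.sum_apply, abs_sub_comm]
        refine le_trans ?_ (le_abs_self _)
        linarith
    _ ≤ ProbabilityTheory.variance (∑ i ∈ Finset.range n, Z i) μ / (m / 2) ^ 2 :=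
        ENNReal.toReal_le_of_le_ofReal (by positivity) hch
    _ = 4 * ProbabilityTheory.variance (∑ i ∈ Finset.range n, Z i) μ / m ^ 2 := by field_simp; norm_num
    _ ≤ _ := by gcongr

lemma aux_up (n : ℕ) (X : ℕ → Ω → ℝ) (t p A E : ℝ) (hXm : ∀ i, Measurable (X i))
    (hX0 : ∀ i ω, 0 ≤ X i ω) (ht : 0 < t) (hp : 0 < p)
    (hA : ∀ i, μ.real {ω | t / 2 < X i ω} ≤ A)
    (hE : ∀ i, ∫ ω, trunc (X i) t ω ^ p ∂μ ≤ E * t ^ p) :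
    μ.real {ω | t ^ p < ∑ i ∈ Finset.range n, X i ω ^ p} ≤ n * A + n * E := by
  have hI := fun i => aux_trunc_int μ (X i) (hXm i) (hX0 i) t p ht hp
  have hmk := mul_meas_ge_le_integral_of_nonneg (μ := μ)
    (f := fun ω => ∑ i ∈ Finset.range n, trunc (X i) t ω ^ p)
    (ae_of_all _ fun ω => Finset.sum_nonneg fun i _ => by
      have := aux_trunc_nn (X i) (hX0 i) t ω; positivity)
    (integrable_finsetSum _ fun i _ => hI i) (t ^ p)
  rw [integral_finsetSum _ fun i _ => hI i] at hmk
  have h1 : ∑ i ∈ Finset.range n, ∫ ω, trunc (X i) t ω ^ p ∂μ ≤ n * (E * t ^ p) := by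
    refine (Finset.sum_le_sum fun i _ => hE i).trans ?_
    simp
  have htp : 0 < t ^ p := by positivity
  have h2 : μ.real {ω | t ^ p ≤ ∑ i ∈ Finset.range n, trunc (X i) t ω ^ p} ≤ n * E := by
    have := hmk.trans h1
    by_contra hcon
    push Not at hcon
    nlinarith
  have h3 : μ.real (⋃ i ∈ Finset.range n, {ω | t / 2 < X i ω}) ≤ n * A := by
    refine (measureReal_biUnion_finset_le _ _).trans ?_
    refine (Finset.sum_le_sum fun i _ => hA i).trans ?_
    simp
  refine le_trans ?_ ((measureReal_union_le (μ := μ) (⋃ i ∈ Finset.range n, {ω | t / 2 < X i ω})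
    {ω | t ^ p ≤ ∑ i ∈ Finset.range n, trunc (X i) t ω ^ p}).trans (add_le_add h3 h2))
  refine measureReal_mono fun ω hω => ?_
  by_cases h : ∃ i ∈ Finset.range n, t / 2 < X i ω
  · left; simpa using h
  · right
    push Not at h
    simp only [Set.mem_ofPred_eq] at hω ⊢
    refine hω.le.trans (le_of_eq (Finset.sum_congr rfl fun i hi => ?_))
    have : trunc (X i) t ω = X i ω := by
      unfold trunc; rw [if_pos]; have := h i hi; linarith
    rw [this]

end helpers2
section helpers3
open Real

lemma aux_ratio (A₁ A₂ a₁ a₂ L R D : ℝ) (hL : 0 < L) (ha₁ : 0 < a₁) (ha₂ : 0 < a₂)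
    (h1 : |A₁ - a₁ * L| ≤ D * R) (h2 : |A₂ - a₂ * L| ≤ D * R) (hR : D * R ≤ a₂ * L / 2) :
    |A₁ / A₂ - a₁ / a₂| ≤ (2 * D * (a₁ + a₂) / a₂ ^ 2) * (R / L) := by
  have hA2 : a₂ * L / 2 ≤ A₂ := by have := (abs_le.1 h2).1; linarith
  have hpos : 0 < a₂ * L / 2 := by positivity
  have hA2p : 0 < A₂ := by linarith
  have hDR : 0 ≤ D * R := (abs_nonneg _).trans h1
  have : A₁ / A₂ - a₁ / a₂ = ((A₁ - a₁ * L) * a₂ - a₁ * (A₂ - a₂ * L)) / (A₂ * a₂) := by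
    field_simp; ring
  rw [this, abs_div, abs_of_pos (by positivity : 0 < A₂ * a₂)]
  have hnum : |(A₁ - a₁ * L) * a₂ - a₁ * (A₂ - a₂ * L)| ≤ D * R * (a₁ + a₂) := by
    refine (abs_sub _ _).trans ?_
    rw [abs_mul, abs_mul, abs_of_pos ha₁, abs_of_pos ha₂]
    nlinarith
  calc _ ≤ (D * R * (a₁ + a₂)) / (a₂ * L / 2 * a₂) := by gcongr
    _ = _ := by field_simp

lemma aux_tendsto_top (F : ℝ → ℝ) (hF : ∀ x, 0 < x → 0 < F x)
    (hanti : ∀ x y, 0 < x → x ≤ y → F y ≤ F x) (a s : ℕ → ℝ) (hs : ∀ n, 0 < s n)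
    (ha : Tendsto a atTop atTop) (h : Tendsto (fun n => a n * F (s n)) atTop (nhds 1)) :
    Tendsto s atTop atTop := by
  rw [tendsto_atTop]
  intro b
  have hb : 0 < F (max b 1) := hF _ (by positivity)
  filter_upwards [h.eventually (gt_mem_nhds (show (1 : ℝ) < 2 by norm_num)),
    ha.eventually_ge_atTop (2 / F (max b 1))] with n h1 h2
  by_contra hcon
  push Not at hcon
  have h3 := hanti (s n) (max b 1) (hs n) (hcon.le.trans (le_max_left _ _))
  rw [div_le_iff₀ hb] at h2
  have : 0 < a n := by
    by_contra h0
    push Not at h0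
    nlinarith
  nlinarith

lemma aux_log_l (F l : ℝ → ℝ) (α : ℝ) (hα : 0 < α) (hF : ∀ x, 0 < x → 0 < F x)
    (hF1 : ∀ x, 0 < x → F x ≤ 1)
    (hanti : ∀ x y, 0 < x → x ≤ y → F y ≤ F x)
    (h2 : Tendsto (fun x => F (2 * x) / F x) atTop (nhds ((2 : ℝ) ^ (-α))))
    (hl : ∀ x, 0 < x → Real.log (l x) = α * Real.log x + Real.log (F x)) (δ : ℝ) (hδ : 0 < δ) :
    ∀ᶠ x in atTop, |Real.log (l x)| ≤ δ * Real.log x := by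
  obtain ⟨C, x0, hC, hx0, hU⟩ := aux_upper F α (α + δ / 2) hF hF1 hanti h2 (by linarith) (by linarith)
  have hq : max (α - δ / 2) (α / 2) < α := max_lt (by linarith) (by linarith)
  have hq0 : 0 < max (α - δ / 2) (α / 2) := lt_max_of_lt_right (by linarith)
  have hq1 := le_max_left (α - δ / 2) (α / 2)
  set q := max (α - δ / 2) (α / 2)
  obtain ⟨C', x0', hC', hx0', hL⟩ := aux_lower F α q hF hanti h2 hq0 hq
  have hlog := Real.tendsto_log_atTop
  set K := |Real.log (F x0)| + |Real.log C| + (α + δ / 2) * |Real.log x0|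
  set K' := |Real.log (F x0')| + |Real.log C'| + q * |Real.log x0'|
  filter_upwards [eventually_ge_atTop x0, eventually_ge_atTop x0',
    hlog.eventually_ge_atTop (2 * K / δ), hlog.eventually_ge_atTop (2 * K' / δ),
    hlog.eventually_ge_atTop 0] with x hx hx' hk hk' hlx
  have hxp : 0 < x := by linarith
  have e1 := hU x x0 hx hx0 hx
  have e2 := hL x0' x le_rfl hx'
  have hFx := hF x hxp
  have hFx0 := hF x0 hx0
  have hFx0' := hF x0' hx0'
  have e1' := Real.log_le_log hFx0 e1
  have e2' := Real.log_le_log hFx e2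
  rw [Real.log_mul (by positivity) (by positivity), Real.log_mul (by positivity) (by positivity),
    Real.log_rpow (by positivity), Real.log_div (by positivity) (by positivity)] at e1' e2'
  rw [div_le_iff₀ hδ] at hk hk'
  rw [hl x hxp, abs_le]
  constructor
  · have a1 := neg_abs_le (Real.log (F x0))
    have a2 := le_abs_self (Real.log C)
    have a3 : -((α + δ / 2) * Real.log x0) ≤ (α + δ / 2) * |Real.log x0| := by
      have := neg_abs_le (Real.log x0)
      nlinarith
    simp only [K] at hk
    nlinarith
  · have a1 := le_abs_self (Real.log (F x0'))
    have a2 := le_abs_self (Real.log C')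
    have a3 : q * Real.log x0' ≤ q * |Real.log x0'| := by
      have := le_abs_self (Real.log x0')
      nlinarith
    simp only [K'] at hk'
    nlinarith

lemma aux_tv (F : ℝ → ℝ) (α : ℝ) (hα : 0 < α) (hF : ∀ x, 0 < x → 0 < F x)
    (hanti : ∀ x y, 0 < x → x ≤ y → F y ≤ F x)
    (h2 : Tendsto (fun x => F (2 * x) / F x) atTop (nhds ((2 : ℝ) ^ (-α))))
    (c t v : ℕ → ℝ) (hc : ∀ n, 0 < c n) (hctop : Tendsto c atTop atTop)
    (htp : ∀ n, 0 < t n) (hvp : ∀ n, 0 < v n) (hvtop : Tendsto v atTop atTop)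
    (ht : Tendsto (fun n : ℕ => (n * c n) * F (t n)) atTop (nhds 1))
    (hv : Tendsto (fun n : ℕ => (n / c n) * F (v n)) atTop (nhds 1)) :
    ∃ B : ℝ, 0 ≤ B ∧ ∀ᶠ n in atTop, Real.log (t n) - Real.log (v n) ≤ B * Real.log (c n) := by
  obtain ⟨C, x0, hC, hx0, hL⟩ := aux_lower F α (α / 2) hF hanti h2 (by linarith) (by linarith)
  refine ⟨(|Real.log (4 * C)| + 2) / (α / 2), by positivity, ?_⟩
  filter_upwards [hvtop.eventually_ge_atTop x0, eventually_ge_atTop 1,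
    ht.eventually (lt_mem_nhds (show (1 / 2 : ℝ) < 1 by norm_num)),
    hv.eventually (gt_mem_nhds (show (1 : ℝ) < 2 by norm_num)),
    (Real.tendsto_log_atTop.comp hctop).eventually_ge_atTop 1] with n h1 hn h3 h4 h5
  simp only [Function.comp] at h5
  have hcn := hc n
  have htn := htp n
  have hvn := hvp n
  have hn0 : (0 : ℝ) < n := by exact_mod_cast hn
  by_cases hvt : v n ≤ t n
  · have h6 := hL _ _ h1 hvt
    have hw : 0 < (v n / t n) ^ (α / 2) := by positivity
    have hFv := hF _ hvn
    have h7 : 1 ≤ 4 * C * c n ^ 2 * (v n / t n) ^ (α / 2) := by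
      have e1 : n * c n * F (t n) ≤ n * c n * (C * (v n / t n) ^ (α / 2) * F (v n)) := by gcongr
      have e2 : n * c n * (C * (v n / t n) ^ (α / 2) * F (v n)) =
          (C * (v n / t n) ^ (α / 2) * c n ^ 2) * (n / c n * F (v n)) := by field_simp
      have e3 : (C * (v n / t n) ^ (α / 2) * c n ^ 2) * (n / c n * F (v n)) ≤
        (C * (v n / t n) ^ (α / 2) * c n ^ 2) * 2 := by gcongr
      nlinarith
    have h8 := Real.log_le_log one_pos h7
    rw [Real.log_one, Real.log_mul (by positivity) (by positivity), Real.log_mul (by positivity) (by positivity),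
      Real.log_pow, Real.log_rpow (by positivity), Real.log_div (by positivity) (by positivity)] at h8
    have a2 := le_abs_self (Real.log (4 * C))
    have a3 := abs_nonneg (Real.log (4 * C))
    rw [div_mul_eq_mul_div, le_div_iff₀ (by positivity)]
    push_cast at h8
    nlinarith
  · push Not at hvt
    have := Real.log_le_log htn hvt.le
    have : 0 ≤ (|Real.log (4 * C)| + 2) / (α / 2) * Real.log (c n) := by positivity
    linarith

lemma aux_R (l : ℝ → ℝ) (α : ℝ) (hα : 0 < α) 
    (hlog : ∀ δ : ℝ, 0 < δ → ∀ᶠ x in atTop, |Real.log (l x)| ≤ δ * Real.log x)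
    (c t : ℕ → ℝ) (httop : Tendsto t atTop atTop)
    (hclog : Tendsto (fun n : ℕ => Real.log (c n) / Real.log n) atTop (nhds 0))
    (h1 : ∀ᶠ n : ℕ in atTop, |α * Real.log (t n) - Real.log n - Real.log (c n) - Real.log (l (t n))| ≤ 1)
    (η : ℝ) (hη : 0 < η) :
    ∀ᶠ n : ℕ in atTop, Real.log (c n) + |Real.log (l (t n))| ≤ η * Real.log n := by
  have hδ : 0 < min (α / 2) (η * α / 12) := lt_min (by linarith) (by positivity)
  have hd1 := min_le_left (α / 2) (η * α / 12)
  have hd2 := min_le_right (α / 2) (η * α / 12)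
  set δ := min (α / 2) (η * α / 12)
  have hη' : 0 < min (η / 2) 1 := lt_min (by linarith) one_pos
  have hm1 := min_le_left (η / 2) 1
  have hm2 := min_le_right (η / 2) 1
  have hL := Real.tendsto_log_atTop.comp (tendsto_natCast_atTop_atTop (R := ℝ))
  filter_upwards [httop.eventually (hlog δ hδ), h1, hclog.eventually (gt_mem_nhds hη'),
    hL.eventually_ge_atTop 1, (Real.tendsto_log_atTop.comp httop).eventually_ge_atTop 0] with n e1 e2 e3 e4 e5
  simp only [Function.comp] at e4 e5
  rw [div_lt_iff₀ (by linarith)] at e3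
  have e6 := (abs_le.1 e2).2
  have e7 := le_abs_self (Real.log (l (t n)))
  have e8 : α / 2 * Real.log (t n) ≤ 3 * Real.log n := by nlinarith
  have e9 : α * (δ * Real.log (t n)) ≤ α * (η / 2 * Real.log n) := by
    have : δ * (α / 2 * Real.log (t n)) ≤ η * α / 12 * (3 * Real.log n) := by
      gcongr
    nlinarith
  have e10 := le_of_mul_le_mul_left e9 hα
  nlinarith

variable {Ω : Type*} [MeasurableSpace Ω] (μ : Measure Ω) [IsProbabilityMeasure μ]

lemma aux_up_tendsto (F : ℝ → ℝ) (α p K : ℝ) (hα : 0 < α) (hp : α < p) (hK : 0 < K)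
    (hF : ∀ x, 0 < x → 0 < F x) (hF1 : ∀ x, 0 < x → F x ≤ 1)
    (hanti : ∀ x y, 0 < x → x ≤ y → F y ≤ F x)
    (h2 : Tendsto (fun x => F (2 * x) / F x) atTop (nhds ((2 : ℝ) ^ (-α))))
    (Y : ℕ → ℕ → Ω → ℝ) (hYm : ∀ n i, Measurable (Y n i)) (hY0 : ∀ n i ω, 0 ≤ Y n i ω)
    (hYK : ∀ n i x, 0 < x → μ.real {ω | x < Y n i ω} ≤ K * F x)
    (c t : ℕ → ℝ) (hc : ∀ n, 0 < c n) (hctop : Tendsto c atTop atTop)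
    (htp : ∀ n, 0 < t n) (httop : Tendsto t atTop atTop)
    (ht : Tendsto (fun n : ℕ => (n * c n) * F (t n)) atTop (nhds 1)) :
    Tendsto (fun n => μ.real {ω | t n ^ p < ∑ i ∈ Finset.range n, Y n i ω ^ p}) atTop (nhds 0) := by
  set q := (α + p) / 2 with hqdef
  have hq0 : 0 < q := by linarith
  have hqa : α < q := by linarith
  have hqp : q < p := by linarith
  have hpq' : 0 < p - q := by linarith
  have hp0 : 0 < p := by linarith
  obtain ⟨C, x0, hC, hx0, hU⟩ := aux_upper F α q hF hF1 hanti h2 hq0 hqa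
  have hlim : Tendsto (fun n : ℕ => (K * C * 2 ^ q + K * C * (p / (p - q))) * ((n * c n) * F (t n) / c n)) atTop (nhds 0) := by
    have := (ht.div_atTop hctop).const_mul (K * C * 2 ^ q + K * C * (p / (p - q)))
    simpa using this
  refine squeeze_zero' (Eventually.of_forall fun n => measureReal_nonneg) ?_ hlim
  filter_upwards [httop.eventually_ge_atTop x0] with n hn
  have htn := htp n
  have hFt := hF _ htn
  refine (aux_up μ n (Y n) (t n) p (K * (C * 2 ^ q * F (t n))) (K * C * F (t n) * (p / (p - q))) (hYm n) (hY0 n) htn hp0 ?_ ?_).trans ?_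
  · intro i
    refine (hYK n i _ (by positivity)).trans ?_
    gcongr
    refine (hU (t n) (t n / 2) hn (by positivity) (by linarith)).trans (le_of_eq ?_)
    congr 3
    field_simp
  · intro i
    refine aux_moment_le μ _ (hYm n i) (hY0 n i) (t n) p q _ htn hq0 hqp (by positivity) ?_
    intro x hx hxt
    refine (hYK n i x hx).trans ?_
    calc K * F x ≤ K * (C * (t n / x) ^ q * F (t n)) := by gcongr; exact hU _ _ hn hx hxt
      _ = _ := by ring
  · have := hc n
    apply le_of_eq
    field_simp

lemma aux_low_tendsto (F : ℝ → ℝ) (α p K ps : ℝ) (hα : 0 < α) (hp : α < p) (hK : 0 < K) (hps : 0 < ps)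
    (hF : ∀ x, 0 < x → 0 < F x) (hF1 : ∀ x, 0 < x → F x ≤ 1)
    (hanti : ∀ x y, 0 < x → x ≤ y → F y ≤ F x)
    (h2 : Tendsto (fun x => F (2 * x) / F x) atTop (nhds ((2 : ℝ) ^ (-α))))
    (Y : ℕ → ℕ → Ω → ℝ) (hYm : ∀ n i, Measurable (Y n i)) (hY0 : ∀ n i ω, 0 ≤ Y n i ω)
    (hYK : ∀ n i x, 0 < x → μ.real {ω | x < Y n i ω} ≤ K * F x)
    (u : ℕ → ℕ) (hun : ∀ᶠ n in atTop, u n ≤ n)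
    (hufrac : Tendsto (fun n : ℕ => (u n : ℝ) / (n : ℝ)) atTop (nhds ps))
    (hYu : ∀ n i x, i < u n → 0 < x → μ.real {ω | x < Y n i ω} = F x)
    (c v : ℕ → ℝ) (hc : ∀ n, 0 < c n) (hctop : Tendsto c atTop atTop)
    (hvp : ∀ n, 0 < v n) (hvtop : Tendsto v atTop atTop)
    (hv : Tendsto (fun n : ℕ => (n / c n) * F (v n)) atTop (nhds 1))
    (hcov : Tendsto (fun n =>
        (∑ i ∈ Finset.range n, ∑ j ∈ Finset.range n,
          if i = j then 0
          else cov μ (fun ω => trunc (Y n i) (v n) ω ^ p)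
            (fun ω => trunc (Y n j) (v n) ω ^ p)) /
          (v n ^ (2 * p) * c n ^ 2)) atTop (nhds 0)) :
    Tendsto (fun n => μ.real {ω | ∑ i ∈ Finset.range n, Y n i ω ^ p < v n ^ p}) atTop (nhds 0) := by
  set q := (α + p) / 2 with hqdef
  have hq0 : 0 < q := by linarith
  have hqa : α < q := by linarith
  have hqp : q < p := by linarith
  have hpq' : 0 < p - q := by linarith
  have hp0 : 0 < p := by linarith
  obtain ⟨C, x0, hC, hx0, hU⟩ := aux_upper F α q hF hF1 hanti h2 hq0 hqa
  have hr1 : (2 : ℝ) ^ (-α) < 1 := Real.rpow_lt_one_of_one_lt_of_neg (by norm_num) (by linarith)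
  obtain ⟨r, hr2, hr3⟩ := exists_between hr1
  have hκ : 0 < 1 - r := by linarith
  set κ := 1 - r with hκdef
  set E0 := K * C * (p / (p - q)) with hE0
  have hE0p : 0 < E0 := by positivity
  set g := ps / 4 * κ * ((1 / 4 : ℝ) ^ p) with hg
  have hgp : 0 < g := by positivity
  set O : ℕ → ℝ := fun n => ∑ i ∈ Finset.range n, ∑ j ∈ Finset.range n,
          if i = j then 0
          else cov μ (fun ω => trunc (Y n i) (v n) ω ^ p)
            (fun ω => trunc (Y n j) (v n) ω ^ p) with hO
  have hlim : Tendsto (fun n : ℕ => 8 * E0 / g ^ 2 / c n + 4 / g ^ 2 * (O n / (v n ^ (2 * p) * c n ^ 2))) atTop (nhds 0) := by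
    have := ((tendsto_const_nhds (x := 8 * E0 / g ^ 2)).div_atTop hctop).add (hcov.const_mul (4 / g ^ 2))
    simpa using this
  refine squeeze_zero' (Eventually.of_forall fun n => measureReal_nonneg) ?_ hlim
  have hr := (hvtop.atTop_div_const (show (0 : ℝ) < 4 by norm_num)).eventually (h2.eventually (gt_mem_nhds hr2))
  filter_upwards [hvtop.eventually_ge_atTop x0, hr, hun, eventually_ge_atTop 1,
    hufrac.eventually (lt_mem_nhds (show ps / 2 < ps by linarith)),
    hv.eventually (lt_mem_nhds (show (1 / 2 : ℝ) < 1 by norm_num)),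
    hv.eventually (gt_mem_nhds (show (1 : ℝ) < 2 by norm_num)),
    hctop.eventually_ge_atTop (2 / g)] with n e1 e2 e3 e4 e5 e6 e7 e8
  have hvn := hvp n
  have hcn := hc n
  have hFv := hF _ hvn
  have hn0 : (0 : ℝ) < n := by exact_mod_cast e4
  have hvpp : 0 < v n ^ p := by positivity
  -- individual moments
  have hup : ∀ i, ∫ ω, trunc (Y n i) (v n) ω ^ p ∂μ ≤ E0 * F (v n) * v n ^ p := by
    intro i
    have := aux_moment_le μ _ (hYm n i) (hY0 n i) (v n) p q (K * C * F (v n)) hvn hq0 hqp (by positivity) (by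
      intro x hx hxt
      refine (hYK n i x hx).trans ?_
      calc K * F x ≤ K * (C * (v n / x) ^ q * F (v n)) := by gcongr; exact hU _ _ e1 hx hxt
        _ = _ := by ring)
    refine this.trans (le_of_eq ?_)
    rw [hE0]; ring
  have hlo : ∀ i, i < u n → (v n / 4) ^ p * (κ * F (v n)) ≤ ∫ ω, trunc (Y n i) (v n) ω ^ p ∂μ := by
    intro i hi
    refine aux_moment_ge μ _ (hYm n i) (hY0 n i) (v n) p _ hvn hp0 ?_
    rw [hYu n i _ hi (by positivity), hYu n i _ hi (by positivity)]
    have hF4 : 0 < F (v n / 4) := hF _ (by positivity)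
    rw [div_lt_iff₀ hF4, show 2 * (v n / 4) = v n / 2 by ring] at e2
    have := hanti (v n / 4) (v n) (by positivity) (by linarith)
    nlinarith
  have hnn : ∀ i, 0 ≤ ∫ ω, trunc (Y n i) (v n) ω ^ p ∂μ := fun i => integral_nonneg fun ω => by
    have := aux_trunc_nn (Y n i) (hY0 n i) (v n) ω
    simp only [Pi.zero_apply]; positivity
  rw [div_mul_eq_mul_div, lt_div_iff₀ hcn] at e6
  rw [div_mul_eq_mul_div, div_lt_iff₀ hcn] at e7
  rw [lt_div_iff₀ hn0] at e5
  rw [div_le_iff₀ hgp] at e8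
  have hsumlo : g * v n ^ p * c n ≤ ∑ i ∈ Finset.range n, ∫ ω, trunc (Y n i) (v n) ω ^ p ∂μ := by
    calc g * v n ^ p * c n = (ps / 2 * ((v n / 4) ^ p * κ)) * (1 / 2 * c n) := by
          rw [hg, div_eq_mul_one_div (v n) 4, Real.mul_rpow hvn.le (by norm_num)]; ring
      _ ≤ (ps / 2 * ((v n / 4) ^ p * κ)) * (n * F (v n)) := by gcongr
      _ = (ps / 2 * n) * ((v n / 4) ^ p * (κ * F (v n))) := by ring
      _ ≤ u n * ((v n / 4) ^ p * (κ * F (v n))) := by gcongr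
      _ = ∑ i ∈ Finset.range (u n), ((v n / 4) ^ p * (κ * F (v n))) := by simp
      _ ≤ ∑ i ∈ Finset.range (u n), ∫ ω, trunc (Y n i) (v n) ω ^ p ∂μ :=
          Finset.sum_le_sum fun i hi => hlo i (Finset.mem_range.1 hi)
      _ ≤ _ := Finset.sum_le_sum_of_subset_of_nonneg (Finset.range_mono e3) fun i _ _ => hnn i
  have hsumup : ∑ i ∈ Finset.range n, ∫ ω, trunc (Y n i) (v n) ω ^ p ∂μ ≤ 2 * E0 * v n ^ p * c n := by
    calc _ ≤ ∑ i ∈ Finset.range n, E0 * F (v n) * v n ^ p := Finset.sum_le_sum fun i _ => hup i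
      _ = E0 * v n ^ p * (n * F (v n)) := by simp; ring
      _ ≤ E0 * v n ^ p * (2 * c n) := by gcongr
      _ = _ := by ring
  have hch := aux_cheb μ n (fun i ω => trunc (Y n i) (v n) ω ^ p) (v n ^ p) (g * v n ^ p * c n)
    (fun i => (aux_trunc_meas _ (hYm n i) _).pow_const p)
    (fun i ω => by have := aux_trunc_nn (Y n i) (hY0 n i) (v n) ω; positivity)
    (fun i ω => by
      have := aux_trunc_nn (Y n i) (hY0 n i) (v n) ω
      have := aux_trunc_le (Y n i) (v n) hvn ω
      gcongr) (by positivity) hsumlo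
  refine le_trans ?_ (hch.trans ?_)
  · refine measureReal_mono fun ω hω => ?_
    simp only [Set.mem_ofPred_eq] at hω ⊢
    have h3 : ∑ i ∈ Finset.range n, trunc (Y n i) (v n) ω ^ p ≤ ∑ i ∈ Finset.range n, Y n i ω ^ p := by
      refine Finset.sum_le_sum fun i _ => ?_
      have := aux_trunc_nn (Y n i) (hY0 n i) (v n) ω
      have := aux_trunc_le' (Y n i) (hY0 n i) (v n) ω
      gcongr
    have h4 : v n ^ p ≤ g * v n ^ p * c n / 2 := by nlinarith
    linarith
  · have hsq : v n ^ (2 * p) = v n ^ p * v n ^ p := by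
      rw [two_mul, Real.rpow_add hvn]
    change 4 * (v n ^ p * ∑ i ∈ Finset.range n, ∫ ω, trunc (Y n i) (v n) ω ^ p ∂μ + O n) / (g * v n ^ p * c n) ^ 2 ≤ _
    calc _ ≤ 4 * (v n ^ p * (2 * E0 * v n ^ p * c n) + O n) / (g * v n ^ p * c n) ^ 2 := by gcongr
      _ = _ := by
        rw [hsq]; field_simp; ring

end helpers3
/-- **Theorem (Taylor's law for higher moments with heterogeneous data).** -/
theorem taylors_law_heterogeneous
    {Ω : Type*} [MeasurableSpace Ω] (μ : Measure Ω) [IsProbabilityMeasure μ]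
    (XU XV : ℕ → Ω → ℝ)
    (hXUmeas : ∀ i, Measurable (XU i)) (hXUnn : ∀ i ω, 0 ≤ XU i ω)
    (hXVmeas : ∀ i, Measurable (XV i)) (hXVnn : ∀ i ω, 0 ≤ XV i ω)
    (α : ℝ) (hα : 0 < α) (hα1 : α < 1)
    (l : ℝ → ℝ) (hlpos : ∀ x : ℝ, 0 < x → 0 < l x) (hl : SlowlyVarying l)
    (hsurvU : ∀ i, ∀ x : ℝ, 0 < x → (μ {ω | x < XU i ω}).toReal = x ^ (-α) * l x)
    (hVident : ∀ i, Measure.map (XV i) μ = Measure.map (XV 0) μ)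
    (hVtail : Tendsto (fun x : ℝ => (μ {ω | x < XV 0 ω}).toReal / (x ^ (-α) * l x))
      atTop (nhds 0))
    (u : ℕ → ℕ) (hu : ∀ n : ℕ, 1 < n → 0 < u n ∧ u n < n)
    (pstar : ℝ) (hpstar0 : 0 < pstar) (hpstar1 : pstar ≤ 1)
    (hufrac : Tendsto (fun n : ℕ => (u n : ℝ) / (n : ℝ)) atTop (nhds pstar))
    (c : ℕ → ℝ) (hc : ∀ n, 0 < c n) (hctop : Tendsto c atTop atTop)
    (hncmono : Monotone fun n : ℕ => (n : ℝ) * c n)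
    (hnctop : Tendsto (fun n : ℕ => (n : ℝ) * c n) atTop atTop)
    (hclog : Tendsto (fun n : ℕ => Real.log (c n) / Real.log n) atTop (nhds 0))
    (t : ℕ → ℝ) (htpos : ∀ n, 0 < t n)
    (ht : Tendsto (fun n : ℕ => (n : ℝ) * c n * l (t n) / t n ^ α) atTop (nhds 1))
    (v : ℕ → ℝ) (hvpos : ∀ n, 0 < v n)
    (hv : Tendsto (fun n : ℕ => (n : ℝ) * l (v n) / (v n ^ α * c n)) atTop (nhds 1))
    (h₁ h₂ : ℝ) (hh₁ : α < h₁) (hh₂ : α < h₂)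
    (hcov : ∀ p : ℝ, p = h₁ ∨ p = h₂ →
      Tendsto (fun n =>
        (∑ i ∈ Finset.range n, ∑ j ∈ Finset.range n,
          if i = j then 0
          else cov μ (fun ω => trunc (hetY XU XV u n i) (v n) ω ^ p)
            (fun ω => trunc (hetY XU XV u n j) (v n) ω ^ p)) /
          (v n ^ (2 * p) * c n ^ 2)) atTop (nhds 0)) :
    IsOp μ (fun n ω =>
        Real.log (hetMoment XU XV u h₁ n ω) / Real.log (hetMoment XU XV u h₂ n ω) -
          (h₁ - α) / (h₂ - α))
      (fun n => (Real.log (c n) + |Real.log (l (t n))|) / Real.log n) := by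
  obtain ⟨F, hFdef⟩ : ∃ F : ℝ → ℝ, ∀ x, F x = x ^ (-α) * l x := ⟨_, fun _ => rfl⟩
  have hF : ∀ x, 0 < x → 0 < F x := fun x hx => by
    rw [hFdef]; have := hlpos x hx; positivity
  have hFU : ∀ i x, 0 < x → μ.real {ω | x < XU i ω} = F x := fun i x hx => by
    rw [hFdef]; exact hsurvU i x hx
  have hF1 : ∀ x, 0 < x → F x ≤ 1 := fun x hx => by
    rw [← hFU 0 x hx]; exact measureReal_le_one
  have hanti : ∀ x y, 0 < x → x ≤ y → F y ≤ F x := fun x y hx hxy => by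
    rw [← hFU 0 x hx, ← hFU 0 y (by linarith)]
    exact measureReal_mono fun ω hω => lt_of_le_of_lt hxy hω
  have h2 : Tendsto (fun x => F (2 * x) / F x) atTop (nhds ((2 : ℝ) ^ (-α))) := by
    have := (hl 2 (by norm_num)).const_mul ((2 : ℝ) ^ (-α))
    rw [mul_one] at this
    refine this.congr' ?_
    filter_upwards [eventually_gt_atTop 0] with x hx
    rw [hFdef, hFdef, Real.mul_rpow (by norm_num) hx.le]
    have := hlpos x hx
    have : 0 < x ^ (-α) := by positivity
    field_simp
  have hF_alt : ∀ x, 0 < x → F x = l x / x ^ α := fun x hx => by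
    rw [hFdef, Real.rpow_neg hx.le]; field_simp
  have ht' : Tendsto (fun n : ℕ => (n * c n) * F (t n)) atTop (nhds 1) := by
    refine ht.congr fun n => ?_
    rw [hF_alt _ (htpos n), mul_div_assoc]
  have hv' : Tendsto (fun n : ℕ => (n / c n) * F (v n)) atTop (nhds 1) := by
    refine hv.congr fun n => ?_
    rw [hF_alt _ (hvpos n)]
    have := hvpos n
    have := hc n
    field_simp
  have hlogtop := Real.tendsto_log_atTop.comp (tendsto_natCast_atTop_atTop (R := ℝ))
  have hncdiv : Tendsto (fun n : ℕ => (n : ℝ) / c n) atTop atTop := by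
    have h := Real.tendsto_exp_atTop.comp (hlogtop.atTop_mul_const (show (0 : ℝ) < 1 / 2 by norm_num))
    refine tendsto_atTop_mono' _ ?_ h
    filter_upwards [hclog.eventually (gt_mem_nhds (show (0 : ℝ) < 1 / 2 by norm_num)),
      hlogtop.eventually_gt_atTop 0, eventually_ge_atTop 1] with n e1 e2 e3
    simp only [Function.comp] at e2 ⊢
    have hn0 : (0 : ℝ) < n := by exact_mod_cast e3
    have hcn := hc n
    rw [div_lt_iff₀ e2] at e1
    rw [← Real.le_log_iff_exp_le (by positivity), Real.log_div hn0.ne' hcn.ne']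
    linarith
  have httop := aux_tendsto_top F hF hanti _ t htpos hnctop ht'
  have hvtop := aux_tendsto_top F hF hanti _ v hvpos hncdiv hv'
  have hllog : ∀ x, 0 < x → Real.log (l x) = α * Real.log x + Real.log (F x) := fun x hx => by
    have := hlpos x hx
    rw [hFdef, Real.log_mul (by positivity) (by positivity), Real.log_rpow hx]; ring
  have hlo := aux_log_l F l α hα hF hF1 hanti h2 hllog
  obtain ⟨B, hB, htv⟩ := aux_tv F α hα hF hanti h2 c t v hc hctop htpos hvpos hvtop ht' hv'
  have h1 : ∀ᶠ n : ℕ in atTop,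
      |α * Real.log (t n) - Real.log n - Real.log (c n) - Real.log (l (t n))| ≤ 1 := by
    have hlg : Tendsto (fun n : ℕ => Real.log ((n * c n) * F (t n))) atTop (nhds 0) := by
      simpa using ht'.log one_ne_zero
    have hlg' := hlg.abs
    rw [abs_zero] at hlg'
    filter_upwards [hlg'.eventually (gt_mem_nhds (show (0 : ℝ) < 1 by norm_num)), eventually_ge_atTop 1] with n e1 e2
    have hn0 : (0 : ℝ) < n := by exact_mod_cast e2
    have hcn := hc n
    have hFn := hF _ (htpos n)
    rw [Real.log_mul (by positivity) (by positivity), Real.log_mul (by positivity) (by positivity)] at e1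
    rw [hllog _ (htpos n), ← abs_neg]
    refine le_trans (le_of_eq ?_) e1.le
    congr 1; ring
  have hR := aux_R l α hα hlo c t httop hclog h1
  -- tails of the V variables
  obtain ⟨K, hK1, hKV⟩ : ∃ K : ℝ, 1 ≤ K ∧ ∀ x, 0 < x → μ.real {ω | x < XV 0 ω} ≤ K * F x := by
    obtain ⟨x1, hx1⟩ := eventually_atTop.1 (hVtail.eventually (gt_mem_nhds (show (0 : ℝ) < 1 by norm_num)))
    have hm : 0 < F (max x1 1) := hF _ (by positivity)
    refine ⟨1 + 1 / F (max x1 1), ?_, fun x hx => ?_⟩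
    · have : 0 < 1 / F (max x1 1) := by positivity
      linarith
    · have hFx := hF x hx
      have hpp : 0 < 1 / F (max x1 1) * F x := by positivity
      by_cases hxx : max x1 1 ≤ x
      · have := hx1 x ((le_max_left _ _).trans hxx)
        rw [← hFdef, div_lt_one hFx] at this
        have h3 : μ.real {ω | x < XV 0 ω} < F x := this
        linarith
      · push Not at hxx
        have h3 := hanti x _ hx hxx.le
        have h4 : 1 ≤ 1 / F (max x1 1) * F x := by
          rw [div_mul_eq_mul_div, one_mul, one_le_div hm]; exact h3
        have h5 : μ.real {ω | x < XV 0 ω} ≤ 1 := measureReal_le_one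
        linarith
  have hK0 : 0 < K := by linarith
  have hVtail' : ∀ i x, 0 < x → μ.real {ω | x < XV i ω} ≤ K * F x := fun i x hx => by
    have e : ∀ j, μ {ω | x < XV j ω} = Measure.map (XV j) μ (Set.Ioi x) := fun j => by
      rw [Measure.map_apply (hXVmeas j) measurableSet_Ioi]; rfl
    have : μ.real {ω | x < XV i ω} = μ.real {ω | x < XV 0 ω} := by
      simp only [Measure.real]; rw [e, e, hVident]
    rw [this]; exact hKV x hx
  have hYm : ∀ n i, Measurable (hetY XU XV u n i) := fun n i => by
    unfold hetY; split_ifs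
    exacts [hXUmeas _, hXVmeas _]
  have hY0 : ∀ n i ω, 0 ≤ hetY XU XV u n i ω := fun n i ω => by
    unfold hetY; split_ifs
    exacts [hXUnn _ _, hXVnn _ _]
  have hYu : ∀ n i x, i < u n → 0 < x → μ.real {ω | x < hetY XU XV u n i ω} = F x := fun n i x hi hx => by
    unfold hetY; rw [if_pos hi]; exact hFU i x hx
  have hYK : ∀ n i x, 0 < x → μ.real {ω | x < hetY XU XV u n i ω} ≤ K * F x := fun n i x hx => by
    by_cases hi : i < u n
    · rw [hYu n i x hi hx]; have := hF x hx; nlinarith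
    · unfold hetY; rw [if_neg hi]; exact hVtail' _ x hx
  have hun : ∀ᶠ n in atTop, u n ≤ n := by
    filter_upwards [eventually_gt_atTop 1] with n hn using (hu n hn).2.le
  have hUp : ∀ p, α < p → Tendsto (fun n => μ.real {ω | t n ^ p < ∑ i ∈ Finset.range n, hetY XU XV u n i ω ^ p}) atTop (nhds 0) :=
    fun p hp => aux_up_tendsto μ F α p K hα hp hK0 hF hF1 hanti h2 _ hYm hY0 hYK c t hc hctop htpos httop ht'
  have hLow : ∀ p, p = h₁ ∨ p = h₂ → Tendsto (fun n => μ.real {ω | ∑ i ∈ Finset.range n, hetY XU XV u n i ω ^ p < v n ^ p}) atTop (nhds 0) :=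
    fun p hp => aux_low_tendsto μ F α p K pstar hα (by rcases hp with rfl | rfl <;> assumption) hK0 hpstar0
      hF hF1 hanti h2 _ hYm hY0 hYK u hun hufrac hYu c v hc hctop hvpos hvtop hv' (hcov p hp)
  -- the deterministic step
  have hdet : ∀ p, 0 < p → ∀ᶠ n : ℕ in atTop, ∀ ω,
      ¬ (t n ^ p < ∑ i ∈ Finset.range n, hetY XU XV u n i ω ^ p) →
      ¬ (∑ i ∈ Finset.range n, hetY XU XV u n i ω ^ p < v n ^ p) →
      |Real.log (hetMoment XU XV u p n ω) - (p / α - 1) * Real.log n| ≤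
        (p / α * 2 + p * B) * (Real.log (c n) + |Real.log (l (t n))|) := by
    intro p hp
    filter_upwards [htv, h1, eventually_ge_atTop 1,
      (Real.tendsto_log_atTop.comp hctop).eventually_ge_atTop 1] with n e1 e2 e3 e4 ω e5 e6
    simp only [Function.comp] at e4
    push Not at e5 e6
    have hn0 : (0 : ℝ) < n := by exact_mod_cast e3
    have htn := htpos n
    have hvn := hvpos n
    have hvpp : 0 < v n ^ p := by positivity
    have hS : 0 < ∑ i ∈ Finset.range n, hetY XU XV u n i ω ^ p := by linarith
    have hlM : Real.log (hetMoment XU XV u p n ω) =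
        Real.log (∑ i ∈ Finset.range n, hetY XU XV u n i ω ^ p) - Real.log n := by
      unfold hetMoment
      rw [Real.log_mul (by positivity) hS.ne', Real.log_inv]; ring
    have f1 := Real.log_le_log hS e5
    have f2 := Real.log_le_log hvpp e6
    rw [Real.log_rpow htn] at f1
    rw [Real.log_rpow hvn] at f2
    rw [hlM]
    have hpa : 0 < p / α := by positivity
    have habs := abs_nonneg (Real.log (l (t n)))
    have hkey : |p * Real.log (t n) - p / α * Real.log n| ≤ p / α * (2 * (Real.log (c n) + |Real.log (l (t n))|)) := by
      have : p * Real.log (t n) - p / α * Real.log n = p / α * (α * Real.log (t n) - Real.log n) := by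
        field_simp
      rw [this, abs_mul, abs_of_pos hpa]
      gcongr
      have g1 := abs_le.1 e2
      have g2 := neg_abs_le (Real.log (l (t n)))
      have g3 := le_abs_self (Real.log (l (t n)))
      rw [abs_le]
      constructor <;> linarith [g1.1, g1.2]
    have hpB : p * (Real.log (t n) - Real.log (v n)) ≤ p * B * (Real.log (c n) + |Real.log (l (t n))|) := by
      rw [mul_assoc]
      gcongr
      refine e1.trans ?_
      gcongr
      linarith
    have hpB0 : 0 ≤ p * B * (Real.log (c n) + |Real.log (l (t n))|) := by
      have : 0 ≤ Real.log (c n) + |Real.log (l (t n))| := by linarith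
      positivity
    have g := abs_le.1 hkey
    rw [abs_le]
    constructor <;> nlinarith [g.1, g.2]
  have hh₁0 : 0 < h₁ := by linarith
  have hh₂0 : 0 < h₂ := by linarith
  have ha₁ : 0 < h₁ / α - 1 := by rw [sub_pos, one_lt_div hα]; exact hh₁
  have ha₂ : 0 < h₂ / α - 1 := by rw [sub_pos, one_lt_div hα]; exact hh₂
  obtain ⟨D, hD⟩ : ∃ D, D = (h₁ / α * 2 + h₁ * B) + (h₂ / α * 2 + h₂ * B) := ⟨_, rfl⟩
  have hd1 : 0 < h₁ / α * 2 + h₁ * B := by positivity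
  have hd2 : 0 < h₂ / α * 2 + h₂ * B := by positivity
  have hDp : 0 < D := by linarith
  intro ε hε
  refine ⟨2 * D * ((h₁ / α - 1) + (h₂ / α - 1)) / (h₂ / α - 1) ^ 2, by positivity, ?_⟩
  have hsum := (((hUp h₁ hh₁).add (hLow h₁ (Or.inl rfl))).add (hUp h₂ hh₂)).add (hLow h₂ (Or.inr rfl))
  simp only [add_zero] at hsum
  filter_upwards [hsum.eventually (gt_mem_nhds hε), hdet h₁ hh₁0, hdet h₂ hh₂0,
    hR ((h₂ / α - 1) / (2 * D)) (by positivity), hlogtop.eventually_gt_atTop 0,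
    (Real.tendsto_log_atTop.comp hctop).eventually_ge_atTop 1] with n e1 e2 e3 e4 e5 e6
  simp only [Function.comp] at e5 e6
  refine lt_of_le_of_lt ?_ e1
  refine le_trans (measureReal_mono (μ := μ) (s₂ := (({ω | t n ^ h₁ < ∑ i ∈ Finset.range n, hetY XU XV u n i ω ^ h₁} ∪
    {ω | ∑ i ∈ Finset.range n, hetY XU XV u n i ω ^ h₁ < v n ^ h₁}) ∪
    {ω | t n ^ h₂ < ∑ i ∈ Finset.range n, hetY XU XV u n i ω ^ h₂}) ∪
    {ω | ∑ i ∈ Finset.range n, hetY XU XV u n i ω ^ h₂ < v n ^ h₂}) ?_) ?_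
  · intro ω hω
    by_contra hcon
    simp only [Set.mem_union, Set.mem_ofPred_eq, not_or] at hcon hω
    obtain ⟨⟨⟨k1, k2⟩, k3⟩, k4⟩ := hcon
    have hR0 : 0 ≤ Real.log (c n) + |Real.log (l (t n))| := by
      have := abs_nonneg (Real.log (l (t n))); linarith
    have j1 := e2 ω k1 k2
    have j2 := e3 ω k3 k4
    have j3 := aux_ratio _ _ _ _ _ (Real.log (c n) + |Real.log (l (t n))|) D e5 ha₁ ha₂
      (j1.trans (by gcongr; linarith)) (j2.trans (by gcongr; linarith)) (by
        calc _ ≤ D * ((h₂ / α - 1) / (2 * D) * Real.log n) := by gcongr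
          _ = _ := by field_simp)
    have j4 : (h₁ / α - 1) / (h₂ / α - 1) = (h₁ - α) / (h₂ - α) := by
      have : h₂ - α ≠ 0 := by linarith
      rw [div_sub_one hα.ne', div_sub_one hα.ne']
      field_simp
    rw [j4] at j3
    linarith
  · refine (measureReal_union_le _ _).trans ?_
    gcongr
    refine (measureReal_union_le _ _).trans ?_
    gcongr
    exact measureReal_union_le _ _
end
end
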